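/- arXiv:cs/0504004 — 6 statements merged into one kernel-verified Lean document; each statement's English description precedes it below -/
import Mathlib

section
/- Let n ≥ 1, ρ > 0, and let s ⊆ {1,…,n} be a subset with |s| = j. Define, for y ∈ V_{n−1}, the extended coordinates ŷ_i = y_i for 1 ≤ i ≤ n−1 and ŷ_n = 1 − Σ_{i=1}^{n−1} y_i. Then the probability under the equal distribution on the top surface of the simplex, namely (n−1)! times the (n−1)-dimensional Lebesgue measure of {y ∈ V_{n−1} : ŷ_m ≥ ρ for all m ∈ s}, equals (1 − jρ)^{n−1} if j ≤ 1/ρ, and equals 0 if j > 1/ρ. -/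
open MeasureTheory Filter

/-- The coordinates of `x` sorted in nondecreasing order. -/
noncomputable def sortedCoords {n : ℕ} (x : Fin n → ℝ) : Fin n → ℝ :=
  fun i => x (Tuple.sort x i)

/-- The circular gaps of `x`: for `i+1 < n` the gap `x'_{i+1} - x'_i` between consecutive
sorted coordinates, and for the last index the boundary gap `x'_1 + 1 - x'_n`. -/
noncomputable def circGap {n : ℕ} (x : Fin n → ℝ) (i : Fin n) : ℝ :=
  if h : (i : ℕ) + 1 < n then sortedCoords x ⟨(i : ℕ) + 1, h⟩ - sortedCoords x i
  else sortedCoords x ⟨0, i.pos⟩ + 1 - sortedCoords x i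

/-- The unit cube `[0,1]^n`, the sample space of the normalized model. -/
def unitBox (n : ℕ) : Set (Fin n → ℝ) := Set.univ.pi fun _ => Set.Icc (0 : ℝ) 1

/-- The event DISC-PB(k): exactly `k` circular gaps are `≥ ρ`. -/
def discPB (n : ℕ) (ρ : ℝ) (k : ℕ) : Set (Fin n → ℝ) :=
  {x ∈ unitBox n | Nat.card {i : Fin n // ρ ≤ circGap x i} = k}

/-- The probability of DISC-PB(k). -/
noncomputable def P_discPB (n : ℕ) (ρ : ℝ) (k : ℕ) : ℝ :=
  (volume (discPB n ρ k)).toReal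

/-- The event CONN-PB: all circular gaps are `< ρ`. -/
def connPB (n : ℕ) (ρ : ℝ) : Set (Fin n → ℝ) :=
  {x ∈ unitBox n | ∀ i, circGap x i < ρ}

/-- The probability of CONN-PB. -/
noncomputable def P_connPB (n : ℕ) (ρ : ℝ) : ℝ :=
  (volume (connPB n ρ)).toReal

/-- The event DISC-DB(k): exactly `k` of the non-circular gaps
`x'_{i+1} - x'_i`, `i = 1, …, n-1`, are `≥ ρ`. -/
def discDB (n : ℕ) (ρ : ℝ) (k : ℕ) : Set (Fin n → ℝ) :=
  {x ∈ unitBox n | Nat.card {i : Fin n // (i : ℕ) + 1 < n ∧ ρ ≤ circGap x i} = k}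

/-- The probability of DISC-DB(k). -/
noncomputable def P_discDB (n : ℕ) (ρ : ℝ) (k : ℕ) : ℝ :=
  (volume (discDB n ρ k)).toReal

/-- The event CONN-DB: all gaps between consecutive sorted coordinates are `< ρ`. -/
def connDB (n : ℕ) (ρ : ℝ) : Set (Fin n → ℝ) :=
  {x ∈ unitBox n | ∀ i : Fin n, ∀ h : (i : ℕ) + 1 < n,
    sortedCoords x ⟨(i : ℕ) + 1, h⟩ - sortedCoords x i < ρ}

/-- The probability of CONN-DB. -/
noncomputable def P_connDB (n : ℕ) (ρ : ℝ) : ℝ :=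
  (volume (connDB n ρ)).toReal

/-- The event S: the network is disconnected at the boundary,
`min_i x_i + 1 - max_i x_i ≥ ρ`. -/
def boundaryDisc (n : ℕ) (ρ : ℝ) : Set (Fin n → ℝ) :=
  {x ∈ unitBox n | ρ ≤ (⨅ i, x i) + 1 - (⨆ i, x i)}

/-- The extended coordinates on the top surface of the simplex: `ŷ_i = y_i` for `i ≤ n-1`
and `ŷ_n = 1 - ∑ y_i`. -/
noncomputable def extCoords (n : ℕ) (y : Fin (n - 1) → ℝ) (i : Fin n) : ℝ :=
  if h : (i : ℕ) < n - 1 then y ⟨(i : ℕ), h⟩ else 1 - ∑ j, y j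

/-- The corner simplex of side length `t`: nonnegative vectors with coordinate sum at most `t`. -/
def cornerSimplex (d : ℕ) (t : ℝ) : Set (Fin d → ℝ) :=
  {y | (∀ i, 0 ≤ y i) ∧ ∑ i, y i ≤ t}

theorem measurableSet_cornerSimplex (d : ℕ) (t : ℝ) : MeasurableSet (cornerSimplex d t) := by
  refine MeasurableSet.inter ?_ ?_
  · exact measurableSet_le (f := fun _ => (0 : Fin d → ℝ)) measurable_const measurable_id
  · exact measurableSet_le (f := fun y : Fin d → ℝ => ∑ i, y i) (by fun_prop) measurable_const

theorem cornerSimplex_of_neg {d : ℕ} {t : ℝ} (ht : t < 0) : cornerSimplex d t = ∅ := by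
  refine Set.eq_empty_of_forall_notMem fun y hy => ?_
  have := Finset.sum_nonneg fun i (_ : i ∈ Finset.univ) => hy.1 i
  linarith [hy.2]

theorem cons_mem_cornerSimplex_iff {d : ℕ} {t x : ℝ} {y : Fin d → ℝ} :
    (Fin.cons x y : Fin (d + 1) → ℝ) ∈ cornerSimplex (d + 1) t ↔
      0 ≤ x ∧ y ∈ cornerSimplex d (t - x) := by
  simp only [cornerSimplex, Set.mem_ofPred_eq, Fin.forall_fin_succ, Fin.sum_univ_succ,
    Fin.cons_zero, Fin.cons_succ, le_sub_iff_add_le', and_assoc]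

theorem volume_cornerSimplex (d : ℕ) {t : ℝ} (ht : 0 ≤ t) :
    volume (cornerSimplex d t) = ENNReal.ofReal (t ^ d / d.factorial) := by
  induction d generalizing t with
  | zero =>
    have : cornerSimplex 0 t = Set.univ := by
      ext y
      simp [cornerSimplex, ht]
    simp [this, volume_pi]
  | succ d ih =>
    have e := (volume_preserving_piFinSuccAbove (fun _ : Fin (d + 1) => ℝ) 0).symm
    have hm := measurableSet_cornerSimplex (d + 1) t
    rw [← e.measure_preimage hm.nullMeasurableSet, Measure.volume_eq_prod,
      Measure.prod_apply (e.measurable hm)]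
    have slice (x : ℝ) : volume (Prod.mk x ⁻¹'
        ((MeasurableEquiv.piFinSuccAbove (fun _ : Fin (d + 1) => ℝ) 0).symm ⁻¹'
          cornerSimplex (d + 1) t)) =
        (Set.Icc 0 t).indicator (fun x => ENNReal.ofReal ((t - x) ^ d / d.factorial)) x := by
      have hs : Prod.mk x ⁻¹' ((MeasurableEquiv.piFinSuccAbove (fun _ : Fin (d + 1) => ℝ) 0).symm ⁻¹'
          cornerSimplex (d + 1) t) = {y | 0 ≤ x ∧ y ∈ cornerSimplex d (t - x)} := by
        ext y
        rw [Set.mem_ofPred_eq, ← cons_mem_cornerSimplex_iff]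
        simp [MeasurableEquiv.piFinSuccAbove, Fin.insertNthEquiv]
      rw [hs]
      by_cases hx : x ∈ Set.Icc 0 t
      · rw [Set.indicator_of_mem hx, ← ih (sub_nonneg.2 hx.2)]
        simp [hx.1]
      · rw [Set.indicator_of_notMem hx]
        by_cases h0 : 0 ≤ x
        · have hxt : t - x < 0 := sub_neg.2 (not_le.1 fun h => hx ⟨h0, h⟩)
          simp [cornerSimplex_of_neg hxt]
        · simp [h0]
    simp_rw [slice]
    rw [lintegral_indicator measurableSet_Icc, ← ofReal_integral_eq_lintegral_ofReal,
      integral_Icc_eq_integral_Ioc, ← intervalIntegral.integral_of_le ht,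
      intervalIntegral.integral_div,
      intervalIntegral.integral_comp_sub_left (fun x => x ^ d) t, integral_pow]
    · congr 1
      rw [Nat.factorial_succ]
      push_cast
      field_simp
      simp
    · exact Continuous.integrableOn_Icc (by fun_prop)
    · filter_upwards [ae_restrict_mem measurableSet_Icc] with x hx
      have := sub_nonneg.2 hx.2
      simp only [Pi.zero_apply]
      positivity

theorem extCoords_castSucc {d : ℕ} (y : Fin d → ℝ) (i : Fin d) :
    extCoords (d + 1) y i.castSucc = y i :=
  dif_pos i.is_lt

theorem extCoords_last {d : ℕ} (y : Fin d → ℝ) :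
    extCoords (d + 1) y (Fin.last d) = 1 - ∑ i, y i :=
  dif_neg (lt_irrefl d)

/-- Requiring the extended coordinates in `s` to be at least `ρ` cuts out a translate of a
smaller corner simplex. -/
theorem setOf_le_extCoords_eq_preimage (d : ℕ) {ρ : ℝ} (hρ : 0 ≤ ρ) (s : Finset (Fin (d + 1))) :
    {y : Fin d → ℝ | ((∀ i, 0 ≤ y i) ∧ ∑ i, y i ≤ 1) ∧ ∀ m ∈ s, ρ ≤ extCoords (d + 1) y m} =
      (fun y => y - fun i : Fin d => if i.castSucc ∈ s then ρ else 0) ⁻¹'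
        cornerSimplex d (1 - s.card * ρ) := by
  have hcard : (s.card : ℝ) * ρ =
      ∑ i : Fin d, (if i.castSucc ∈ s then ρ else 0) + if Fin.last d ∈ s then ρ else 0 := by
    rw [← Fin.sum_univ_castSucc fun i : Fin (d + 1) => if i ∈ s then ρ else 0]
    simp
  ext y
  simp only [Set.mem_ofPred_eq, Set.mem_preimage, cornerSimplex, Pi.sub_apply,
    Finset.sum_sub_distrib, hcard, Fin.forall_fin_succ', extCoords_castSucc, extCoords_last]
  constructor
  · rintro ⟨⟨h0, h1⟩, hs, hl⟩
    refine ⟨fun i => ?_, ?_⟩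
    · split_ifs with h
      · linarith [hs i h]
      · linarith [h0 i]
    · split_ifs with h
      · linarith [hl h]
      · linarith
  · rintro ⟨h0, h1⟩
    refine ⟨⟨fun i => ?_, ?_⟩, fun i h => ?_, fun h => ?_⟩
    · have := h0 i
      split_ifs at this <;> linarith
    · split_ifs at h1 <;> linarith
    · have := h0 i
      rw [if_pos h] at this
      linarith
    · rw [if_pos h] at h1
      linarith

/-- the probability, under the equal distribution on the top surface of the
standard simplex, that the `j` extended coordinates indexed by `s` are all `≥ ρ` is
`(1 - jρ)^{n-1}` if `j ≤ 1/ρ` and `0` otherwise. -/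
theorem simplex_gap_probability (n j : ℕ) (hn : 1 ≤ n) (ρ : ℝ) (hρ : 0 < ρ)
    (s : Finset (Fin n)) (hs : s.card = j) :
    (Nat.factorial (n - 1) : ℝ) *
      (volume {y : Fin (n - 1) → ℝ |
        ((∀ i, 0 ≤ y i) ∧ ∑ i, y i ≤ 1) ∧ ∀ m ∈ s, ρ ≤ extCoords n y m}).toReal
    = if (j : ℝ) ≤ 1 / ρ then (1 - (j : ℝ) * ρ) ^ (n - 1) else 0 := by
  obtain ⟨d, rfl⟩ := Nat.exists_eq_add_of_le' hn
  subst hs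
  change (d.factorial : ℝ) * (volume {y : Fin d → ℝ |
    ((∀ i, 0 ≤ y i) ∧ ∑ i, y i ≤ 1) ∧ ∀ m ∈ s, ρ ≤ extCoords (d + 1) y m}).toReal =
      if (s.card : ℝ) ≤ 1 / ρ then (1 - (s.card : ℝ) * ρ) ^ d else 0
  rw [setOf_le_extCoords_eq_preimage d hρ.le s, (measurePreserving_sub_right volume _).measure_preimage
    (measurableSet_cornerSimplex d _).nullMeasurableSet]
  simp only [le_div_iff₀ hρ]
  split_ifs with h
  · have h' : 0 ≤ 1 - (s.card : ℝ) * ρ := sub_nonneg.2 h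
    rw [volume_cornerSimplex d h', ENNReal.toReal_ofReal (by positivity)]
    field_simp
  · rw [cornerSimplex_of_neg (by linarith)]
    simp
end

section
/- Let (ρ_n) be a sequence of positive reals and η ∈ ℝ such that n·ρ_n − ln n → η as n → ∞. Then for every k ∈ ℕ, the probability that the 1-dimensional MANET with periodic boundary conditions is disconnected at exactly k places satisfies P_{DISC-PB(k)}(n, ρ_n) → (e^{−ηk}/k!) · exp(−e^{−η}) as n → ∞. -/
open MeasureTheory Filter

/-- The Bonferroni inequality for the indicator of `N = k`, in terms of binomial moments. -/
lemma abs_ite_eq_sub_sum_choose_le (N k M : ℕ) :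
    |(if N = k then (1 : ℝ) else 0) - ∑ m ∈ Finset.range (M + 1),
      (-1) ^ m * ((k + m).choose k : ℝ) * (N.choose (k + m) : ℝ)|
      ≤ ((k + (M + 1)).choose k : ℝ) * (N.choose (k + (M + 1)) : ℝ) := by
  rcases lt_or_ge N k with hN | hN
  · rw [if_neg hN.ne, Finset.sum_eq_zero, sub_zero, abs_zero]
    · positivity
    · intro m _
      rw [Nat.choose_eq_zero_of_lt (by omega : N < k + m)]
      simp
  · obtain ⟨r, rfl⟩ := Nat.exists_eq_add_of_le hN
    have hmul (m : ℕ) : ((k + m).choose k : ℝ) * ((k + r).choose (k + m) : ℝ)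
        = ((k + r).choose k : ℝ) * (r.choose m : ℝ) := by
      have := Nat.choose_mul (n := k + r) (k := k + m) (s := k) (by omega)
      simp only [Nat.add_sub_cancel_left] at this
      rw [mul_comm]
      exact_mod_cast this
    simp_rw [mul_assoc, hmul]
    rcases r with _ | s
    · rw [Finset.sum_range_succ', Finset.sum_eq_zero]
      · simp
      · simp
    · have hsum : ∑ m ∈ Finset.range (M + 1), (-1 : ℝ) ^ m * ((s + 1).choose m : ℝ)
          = (-1) ^ M * (s.choose M : ℝ) := by
        exact_mod_cast Int.alternating_sum_range_choose_eq_choose (n := s) (m := M)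
      rw [if_neg (by omega), zero_sub, abs_neg]
      simp_rw [mul_left_comm _ ((k + (s + 1)).choose k : ℝ)]
      rw [← Finset.mul_sum, hsum, abs_mul, abs_mul, abs_pow, abs_neg, abs_one, one_pow, one_mul,
        Nat.abs_cast, Nat.abs_cast]
      gcongr
      rw [Nat.choose_succ_succ]
      omega

/-- Convergence of all binomial moments to those of a Poisson law implies convergence of the
point probabilities. -/
lemma tendsto_poisson_of_bonferroni {l : ℝ} {k : ℕ} {p : ℕ → ℝ} {B : ℕ → ℕ → ℝ}
    (hp : ∀ M n, |p n - ∑ m ∈ Finset.range (M + 1),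
      (-1) ^ m * ((k + m).choose k : ℝ) * B n (k + m)|
      ≤ ((k + (M + 1)).choose k : ℝ) * B n (k + (M + 1)))
    (hB : ∀ j, Tendsto (fun n => B n j) atTop (nhds (l ^ j / j.factorial))) :
    Tendsto p atTop (nhds (l ^ k / k.factorial * Real.exp (-l))) := by
  have hch (m : ℕ) : ((k + m).choose k : ℝ) * (l ^ (k + m) / (k + m).factorial)
      = l ^ k / k.factorial * (l ^ m / m.factorial) := by
    rw [Nat.cast_add_choose]
    field_simp
    ring
  have hexp : Tendsto (fun M => l ^ k / k.factorial *
      ∑ m ∈ Finset.range (M + 1), (-l) ^ m / (m.factorial : ℝ)) atTop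
      (nhds (l ^ k / k.factorial * Real.exp (-l))) := by
    rw [Real.exp_eq_exp_ℝ]
    exact (((NormedSpace.expSeries_div_hasSum_exp (-l)).tendsto_sum_nat).comp
      (tendsto_add_atTop_nat 1)).const_mul _
  have herr : Tendsto (fun M => l ^ k / k.factorial *
      (l ^ (M + 1) / ((M + 1).factorial : ℝ))) atTop (nhds 0) := by
    simpa using ((FloorSemiring.tendsto_pow_div_factorial_atTop l).comp
      (tendsto_add_atTop_nat 1)).const_mul (l ^ k / k.factorial : ℝ)
  rw [Metric.tendsto_atTop]
  intro ε hε
  obtain ⟨M, hM1, hM2⟩ := ((Metric.tendsto_nhds.1 hexp (ε / 4) (by positivity)).and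
    (Metric.tendsto_nhds.1 herr (ε / 4) (by positivity))).exists
  have hS : Tendsto (fun n => ∑ m ∈ Finset.range (M + 1),
      (-1) ^ m * ((k + m).choose k : ℝ) * B n (k + m)) atTop
      (nhds (l ^ k / k.factorial * ∑ m ∈ Finset.range (M + 1), (-l) ^ m / (m.factorial : ℝ))) := by
    rw [Finset.mul_sum]
    refine tendsto_finsetSum _ fun m _ => ?_
    convert (hB (k + m)).const_mul ((-1) ^ m * ((k + m).choose k : ℝ)) using 2
    rw [mul_assoc, hch, neg_pow]
    ring
  have hR : Tendsto (fun n => ((k + (M + 1)).choose k : ℝ) * B n (k + (M + 1))) atTop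
      (nhds (l ^ k / k.factorial * (l ^ (M + 1) / ((M + 1).factorial : ℝ)))) := by
    rw [← hch]
    exact (hB _).const_mul _
  have hev := (Metric.tendsto_nhds.1 hS (ε / 4) (by positivity)).and
    (Metric.tendsto_nhds.1 hR (ε / 4) (by positivity))
  obtain ⟨n₀, hn₀⟩ := eventually_atTop.1 hev
  refine ⟨n₀, fun n hn => ?_⟩
  obtain ⟨h1, h2⟩ := hn₀ n hn
  have h3 := hp M n
  rw [Real.dist_eq] at *
  grind [abs_le, abs_lt]

/-- The Bonferroni inequalities for the probability that exactly `k` of finitely many events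
occur. -/
lemma abs_measureReal_card_eq_sub_sum_le {Ω ι : Type*} [MeasurableSpace Ω] [Fintype ι]
    (ν : Measure Ω) [IsProbabilityMeasure ν] {E : ι → Set Ω}
    (hE : ∀ i, MeasurableSet (E i)) (k M : ℕ) :
    |ν.real {x | Nat.card {i // x ∈ E i} = k} - ∑ m ∈ Finset.range (M + 1),
      (-1) ^ m * ((k + m).choose k : ℝ) *
        ∑ S ∈ Finset.powersetCard (k + m) Finset.univ, ν.real (⋂ i ∈ S, E i)|
      ≤ ((k + (M + 1)).choose k : ℝ) *
        ∑ S ∈ Finset.powersetCard (k + (M + 1)) Finset.univ, ν.real (⋂ i ∈ S, E i) := by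
  classical
  let N : Ω → ℕ := fun x => Nat.card {i // x ∈ E i}
  have hNcard (x : Ω) : N x = (Finset.univ.filter fun i => x ∈ E i).card := by
    simp only [N, Nat.card_eq_fintype_card, Fintype.card_subtype]
  have hinter (S : Finset ι) : MeasurableSet (⋂ i ∈ S, E i) :=
    S.measurableSet_biInter fun i _ => hE i
  have hchoose (j : ℕ) (x : Ω) : ((N x).choose j : ℝ) =
      ∑ S ∈ Finset.powersetCard j Finset.univ, (⋂ i ∈ S, E i).indicator (fun _ => (1 : ℝ)) x := by
    rw [hNcard, ← Finset.card_powersetCard]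
    simp only [Set.indicator_apply, Finset.sum_boole, Set.mem_iInter]
    congr 2
    ext S
    simp only [Finset.mem_powersetCard, Finset.mem_filter, true_and,
      Finset.subset_iff, Finset.mem_univ]
    tauto
  have hN : Measurable N := by
    have : N = fun x => ∑ i, if x ∈ E i then 1 else 0 := by
      ext x
      rw [hNcard, Finset.sum_boole, Nat.cast_id]
    rw [this]
    exact Finset.measurable_sum _ fun i _ => Measurable.ite (hE i) measurable_const measurable_const
  have hint1 (S : Finset ι) : Integrable ((⋂ i ∈ S, E i).indicator fun _ => (1 : ℝ)) ν :=
    (integrable_const _).indicator (hinter S)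
  have hintc (j : ℕ) : Integrable (fun x => ((N x).choose j : ℝ)) ν := by
    simp_rw [hchoose]
    exact integrable_finsetSum _ fun S _ => hint1 S
  have hmom (j : ℕ) : ∑ S ∈ Finset.powersetCard j Finset.univ, ν.real (⋂ i ∈ S, E i)
      = ∫ x, ((N x).choose j : ℝ) ∂ν := by
    simp_rw [hchoose]
    rw [integral_finsetSum _ fun S _ => hint1 S]
    exact Finset.sum_congr rfl fun S _ => (integral_indicator_one (hinter S)).symm
  have hset : MeasurableSet {x | N x = k} := hN (measurableSet_singleton k)
  have hite : (fun x => if N x = k then (1 : ℝ) else 0)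
      = {x | N x = k}.indicator fun _ => (1 : ℝ) := by
    ext x
    simp [Set.indicator_apply]
  have hint : Integrable (fun x => if N x = k then (1 : ℝ) else 0) ν := by
    rw [hite]
    exact (integrable_const _).indicator hset
  have hprob : ν.real {x | N x = k} = ∫ x, (if N x = k then (1 : ℝ) else 0) ∂ν := by
    rw [hite]
    exact (integral_indicator_one hset).symm
  simp_rw [hmom]
  change |ν.real {x | N x = k} - _| ≤ _
  have hterm (m : ℕ) : Integrable (fun x => (-1 : ℝ) ^ m * ((k + m).choose k : ℝ) *
      ((N x).choose (k + m) : ℝ)) ν := (hintc _).const_mul _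
  simp_rw [hprob, ← integral_const_mul]
  rw [← integral_finsetSum _ fun m _ => hterm m,
    ← integral_sub hint (integrable_finsetSum _ fun m _ => hterm m)]
  refine abs_integral_le_integral_abs.trans (integral_mono ?_ ((hintc _).const_mul _) fun x =>
    abs_ite_eq_sub_sum_choose_le (N x) k M)
  exact (hint.sub (integrable_finsetSum _ fun m _ => hterm m)).abs

lemma tendsto_natCast_mul_sq_zero {ρ : ℕ → ℝ} {η : ℝ}
    (h : Tendsto (fun n : ℕ => (n : ℝ) * ρ n - Real.log n) atTop (nhds η)) :
    Tendsto (fun n : ℕ => (n : ℝ) * ρ n ^ 2) atTop (nhds 0) := by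
  have hsq : Tendsto (fun n : ℕ => √(n : ℝ)) atTop atTop :=
    Real.tendsto_sqrt_atTop.comp tendsto_natCast_atTop_atTop
  have hlog : Tendsto (fun n : ℕ => Real.log n / √(n : ℝ)) atTop (nhds 0) := by
    have := ((isLittleO_log_rpow_atTop (r := 1 / 2) (by norm_num)).tendsto_div_nhds_zero).comp
      tendsto_natCast_atTop_atTop
    simpa [Function.comp_def, Real.sqrt_eq_rpow] using this
  have h1 := (((h.div_atTop hsq).add hlog).pow 2)
  simp only [add_zero, ne_eq, OfNat.ofNat_ne_zero, not_false_eq_true, zero_pow] at h1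
  refine h1.congr' ?_
  filter_upwards [eventually_gt_atTop 0] with n hn
  have hn' : (0 : ℝ) < n := by exact_mod_cast hn
  rw [← add_div, sub_add_cancel, div_pow, Real.sq_sqrt hn'.le]
  field_simp

lemma tendsto_zero_of_natCast_mul_sub_log {ρ : ℕ → ℝ} {η : ℝ}
    (h : Tendsto (fun n : ℕ => (n : ℝ) * ρ n - Real.log n) atTop (nhds η)) :
    Tendsto ρ atTop (nhds 0) := by
  have h1 : Tendsto (fun n : ℕ => ρ n ^ 2) atTop (nhds 0) := by
    refine squeeze_zero' (Eventually.of_forall fun n => sq_nonneg _) ?_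
      (tendsto_natCast_mul_sq_zero h)
    filter_upwards [eventually_gt_atTop 0] with n hn
    have hn' : (1 : ℝ) ≤ n := by exact_mod_cast hn
    nlinarith [sq_nonneg (ρ n)]
  have h2 := h1.sqrt
  simp only [Real.sqrt_sq_eq_abs, Real.sqrt_zero] at h2
  exact (tendsto_zero_iff_abs_tendsto_zero _).2 h2

lemma tendsto_choose_mul_one_sub_pow {ρ : ℕ → ℝ} {η : ℝ}
    (h : Tendsto (fun n : ℕ => (n : ℝ) * ρ n - Real.log n) atTop (nhds η)) (j : ℕ) :
    Tendsto (fun n : ℕ => (n.choose j : ℝ) * (1 - j * ρ n) ^ (n - j)) atTop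
      (nhds (Real.exp (-η) ^ j / j.factorial)) := by
  have hρ0 := tendsto_zero_of_natCast_mul_sub_log h
  have hx : Tendsto (fun n => (j : ℝ) * ρ n) atTop (nhds 0) := by simpa using hρ0.const_mul (j : ℝ)
  have hx1 : ∀ᶠ n in atTop, |(j : ℝ) * ρ n| < 1 := by
    have := hx.abs
    rw [abs_zero] at this
    exact this.eventually_lt_const one_pos
  have hrem : Tendsto (fun n : ℕ => (n : ℝ) * (j * ρ n + Real.log (1 - j * ρ n)))
      atTop (nhds 0) := by
    have hb : Tendsto (fun n : ℕ => (j : ℝ) ^ 2 * (n * ρ n ^ 2) / (1 - |j * ρ n|)) atTop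
        (nhds 0) := by
      have := ((tendsto_natCast_mul_sq_zero h).const_mul ((j : ℝ) ^ 2)).div
        (hx.abs.const_sub 1) (by simp)
      rwa [mul_zero, zero_div] at this
    refine squeeze_zero_norm' ?_ hb
    filter_upwards [hx1] with n hn
    have := Real.abs_log_sub_add_sum_range_le hn 1
    simp only [Finset.sum_range_one, zero_add, pow_one, Nat.cast_zero, div_one, Nat.reduceAdd,
      sq_abs] at this
    rw [Real.norm_eq_abs, abs_mul, Nat.abs_cast]
    calc (n : ℝ) * |j * ρ n + Real.log (1 - j * ρ n)|
        ≤ n * ((j * ρ n) ^ 2 / (1 - |j * ρ n|)) := by gcongr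
      _ = _ := by ring
  have hmain : Tendsto (fun n : ℕ => (n : ℝ) ^ j * (1 - j * ρ n) ^ n) atTop
      (nhds (Real.exp (-η) ^ j)) := by
    have h1 : Tendsto (fun n : ℕ => Real.exp (-(j * (n * ρ n - Real.log n)) +
        n * (j * ρ n + Real.log (1 - j * ρ n)))) atTop (nhds (Real.exp (-η) ^ j)) := by
      have := ((h.const_mul (j : ℝ)).neg.add hrem).rexp
      rwa [add_zero, ← mul_neg, Real.exp_nat_mul] at this
    refine h1.congr' ?_
    filter_upwards [hx1, eventually_gt_atTop 0] with n hn hn0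
    have hn' : (0 : ℝ) < n := by exact_mod_cast hn0
    have hpos : 0 < 1 - j * ρ n := by linarith [(abs_lt.1 hn).2]
    rw [show -(j * (n * ρ n - Real.log n)) + n * (j * ρ n + Real.log (1 - j * ρ n))
      = j * Real.log n + n * Real.log (1 - j * ρ n) by ring, Real.exp_add, Real.exp_nat_mul,
      Real.exp_nat_mul, Real.exp_log hn', Real.exp_log hpos]
  have hinv : Tendsto (fun n => ((1 - j * ρ n) ^ j)⁻¹) atTop (nhds 1) := by
    have := ((hx.const_sub 1).pow j).inv₀ (by simp)
    simpa using this
  have hch : Tendsto (fun n : ℕ => (n.choose j : ℝ) / n ^ j) atTop (nhds (1 / j.factorial)) := by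
    have h2 := (Asymptotics.isEquivalent_iff_tendsto_one ?_).1 (isEquivalent_choose j)
    · have := h2.mul_const (1 / (j.factorial : ℝ))
      rw [one_mul] at this
      refine this.congr fun n => ?_
      simp only [Pi.div_apply]
      field_simp
    · filter_upwards [eventually_gt_atTop 0] with n hn
      positivity
  have := (hch.mul hmain).mul hinv
  rw [mul_one, one_div_mul_eq_div] at this
  refine this.congr' ?_
  filter_upwards [hx1, eventually_gt_atTop 0, eventually_ge_atTop j] with n hn hn0 hj
  have hn' : (0 : ℝ) < n := by exact_mod_cast hn0
  have hpos : 0 < 1 - j * ρ n := by linarith [(abs_lt.1 hn).2]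
  rw [pow_sub₀ _ hpos.ne' hj]
  field_simp

/-- The uniform distribution on `[0,1)`. -/
noncomputable def unitUniform : Measure ℝ := volume.restrict (Set.Ico 0 1)

instance : IsProbabilityMeasure unitUniform := ⟨by simp [unitUniform]⟩

lemma fract_sub_of_mem_Ico {a y : ℝ} (ha : a ∈ Set.Ico (0 : ℝ) 1) (hy : y ∈ Set.Ico (0 : ℝ) 1) :
    Int.fract (y - a) = if a ≤ y then y - a else y - a + 1 := by
  obtain ⟨ha0, ha1⟩ := ha
  obtain ⟨hy0, hy1⟩ := hy
  split_ifs with h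
  · exact Int.fract_eq_self.2 ⟨by linarith, by linarith⟩
  · exact Int.fract_eq_iff.2 ⟨by linarith, by linarith, -1, by push_cast; ring⟩

lemma measurableSet_fract_sub_lt (a ρ : ℝ) : MeasurableSet {y : ℝ | Int.fract (y - a) < ρ} :=
  measurableSet_lt (by fun_prop) measurable_const

lemma unitUniform_real_fract_sub_lt (a : ℝ) {ρ : ℝ} (h0 : 0 ≤ ρ) (h1 : ρ ≤ 1) :
    unitUniform.real {y | Int.fract (y - a) < ρ} = ρ := by
  wlog ha : a ∈ Set.Ico (0 : ℝ) 1 generalizing a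
  · convert this (Int.fract a) ⟨Int.fract_nonneg a, Int.fract_lt_one a⟩ using 4 with y
    have : y - Int.fract a = y - a + (⌊a⌋ : ℤ) := by
      rw [← Int.self_sub_floor]
      ring
    rw [this, Int.fract_add_intCast]
  rw [unitUniform, measureReal_restrict_apply (measurableSet_fract_sub_lt a ρ)]
  obtain ⟨ha0, ha1⟩ := id ha
  rcases le_or_gt (a + ρ) 1 with h | h
  · have : {y | Int.fract (y - a) < ρ} ∩ Set.Ico 0 1 = Set.Ico a (a + ρ) := by
      ext y
      constructor
      · rintro ⟨hy, hy'⟩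
        rw [Set.mem_ofPred_eq, fract_sub_of_mem_Ico ha hy'] at hy
        obtain ⟨hy0, hy1⟩ := hy'
        split_ifs at hy
        · exact ⟨by linarith, by linarith⟩
        · linarith
      · rintro ⟨hy0, hy1⟩
        have hy' : y ∈ Set.Ico (0 : ℝ) 1 := ⟨by linarith, by linarith⟩
        refine ⟨?_, hy'⟩
        rw [Set.mem_ofPred_eq, fract_sub_of_mem_Ico ha hy', if_pos hy0]
        linarith
    rw [this, Real.volume_real_Ico_of_le (by linarith)]
    ring
  · have : {y | Int.fract (y - a) < ρ} ∩ Set.Ico 0 1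
        = Set.Ico a 1 ∪ Set.Ico 0 (a + ρ - 1) := by
      ext y
      constructor
      · rintro ⟨hy, hy'⟩
        rw [Set.mem_ofPred_eq, fract_sub_of_mem_Ico ha hy'] at hy
        obtain ⟨hy0, hy1⟩ := hy'
        split_ifs at hy
        · exact Or.inl ⟨by linarith, by linarith⟩
        · exact Or.inr ⟨by linarith, by linarith⟩
      · rintro (⟨hy0, hy1⟩ | ⟨hy0, hy1⟩)
        · have hy' : y ∈ Set.Ico (0 : ℝ) 1 := ⟨by linarith, by linarith⟩
          refine ⟨?_, hy'⟩
          rw [Set.mem_ofPred_eq, fract_sub_of_mem_Ico ha hy', if_pos hy0]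
          linarith
        · have hy' : y ∈ Set.Ico (0 : ℝ) 1 := ⟨by linarith, by linarith⟩
          refine ⟨?_, hy'⟩
          rw [Set.mem_ofPred_eq, fract_sub_of_mem_Ico ha hy', if_neg (by linarith)]
          linarith
    rw [this, measureReal_union _ measurableSet_Ico (by simp) (by simp), Real.volume_real_Ico_of_le (by linarith),
      Real.volume_real_Ico_of_le (by linarith)]
    · ring
    · rw [Set.disjoint_left]
      rintro y ⟨hy0, hy1⟩ ⟨hy2, hy3⟩
      linarith

lemma fract_sub_lt_or_of_fract_sub_lt {a b y ρ : ℝ} (ha : Int.fract (y - a) < ρ)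
    (hb : Int.fract (y - b) < ρ) : Int.fract (a - b) < ρ ∨ Int.fract (b - a) < ρ := by
  wlog h : Int.fract (y - a) ≤ Int.fract (y - b) generalizing a b
  · exact (this hb ha (le_of_not_ge h)).symm
  left
  have h0 := Int.fract_nonneg (y - a)
  have h1 := Int.fract_lt_one (y - b)
  have : Int.fract (a - b) = Int.fract (y - b) - Int.fract (y - a) := by
    refine Int.fract_eq_iff.2 ⟨by linarith, by linarith, ⌊y - b⌋ - ⌊y - a⌋, ?_⟩
    rw [← Int.self_sub_floor, ← Int.self_sub_floor]
    push_cast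
    ring
  linarith

lemma unitUniform_real_forall_le_fract_sub {κ : Type*} [Fintype κ] {a : κ → ℝ} {ρ : ℝ}
    (h0 : 0 ≤ ρ) (h1 : ρ ≤ 1) (ha : ∀ i j, j ≠ i → ρ ≤ Int.fract (a j - a i)) :
    unitUniform.real {y | ∀ i, ρ ≤ Int.fract (y - a i)} = 1 - Fintype.card κ * ρ := by
  have : {y | ∀ i, ρ ≤ Int.fract (y - a i)} = (⋃ i, {y | Int.fract (y - a i) < ρ})ᶜ := by
    ext y
    simp
  rw [this, probReal_compl_eq_one_sub
    (MeasurableSet.iUnion fun i => measurableSet_fract_sub_lt (a i) ρ),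
    measureReal_iUnion_fintype _ fun i => measurableSet_fract_sub_lt (a i) ρ]
  · simp [unitUniform_real_fract_sub_lt _ h0 h1]
  · intro i j hij
    rw [Function.onFun, Set.disjoint_left]
    intro y hi hj
    rcases fract_sub_lt_or_of_fract_sub_lt hi hj with h | h
    · exact (ha j i hij).not_gt h
    · exact (ha i j hij.symm).not_gt h

lemma pi_unitUniform_real_fract_sub_lt {κ : Type*} [Fintype κ] {i j : κ} (hij : j ≠ i) {ρ : ℝ}
    (h0 : 0 ≤ ρ) (h1 : ρ ≤ 1) :
    (Measure.pi fun _ : κ => unitUniform).real {x | Int.fract (x j - x i) < ρ} = ρ := by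
  have hind := (ProbabilityTheory.iIndepFun_pi (μ := fun _ : κ => unitUniform)
    (X := fun _ => id) fun _ => aemeasurable_id).indepFun hij.symm
  simp only [id] at hind
  rw [ProbabilityTheory.indepFun_iff_map_prod_eq_prod_map_map
    (measurable_pi_apply i).aemeasurable (measurable_pi_apply j).aemeasurable] at hind
  have hmap (l : κ) : (Measure.pi fun _ : κ => unitUniform).map (fun x => x l)
      = unitUniform := (measurePreserving_eval (fun _ : κ => unitUniform) l).map_eq
  rw [hmap, hmap] at hind
  have hmeas : MeasurableSet {p : ℝ × ℝ | Int.fract (p.2 - p.1) < ρ} :=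
    measurableSet_lt (by fun_prop) measurable_const
  have h2 : (Measure.pi fun _ : κ => unitUniform).real {x | Int.fract (x j - x i) < ρ}
      = (unitUniform.prod unitUniform).real {p : ℝ × ℝ | Int.fract (p.2 - p.1) < ρ} := by
    rw [← hind, map_measureReal_apply (by fun_prop) hmeas]
    rfl
  have h3 (a : ℝ) : unitUniform (Prod.mk a ⁻¹' {p : ℝ × ℝ | Int.fract (p.2 - p.1) < ρ})
      = ENNReal.ofReal ρ := by
    conv_rhs => rw [← unitUniform_real_fract_sub_lt a h0 h1, ofReal_measureReal]
    rfl
  rw [h2, measureReal_def, Measure.prod_apply hmeas]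
  simp only [h3, lintegral_const, measure_univ, mul_one, ENNReal.toReal_ofReal h0]

/-- The set of configurations whose points are pairwise at circular distance at least `ρ`. -/
def circSeparated (κ : Type*) (ρ : ℝ) : Set (κ → ℝ) :=
  {a | ∀ i j, j ≠ i → ρ ≤ Int.fract (a j - a i)}

lemma measurableSet_circSeparated (κ : Type*) [Fintype κ] (ρ : ℝ) :
    MeasurableSet (circSeparated κ ρ) := by
  have : circSeparated κ ρ = ⋂ i, ⋂ j, ⋂ _ : j ≠ i, {a | ρ ≤ Int.fract (a j - a i)} := by
    ext a
    simp [circSeparated]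
  rw [this]
  exact MeasurableSet.iInter fun i => MeasurableSet.iInter fun j => MeasurableSet.iInter fun _ =>
    measurableSet_le measurable_const (by fun_prop)

lemma one_sub_le_pi_unitUniform_real_circSeparated (κ : Type*) [Fintype κ] {ρ : ℝ}
    (h0 : 0 ≤ ρ) (h1 : ρ ≤ 1) :
    1 - (Fintype.card κ : ℝ) ^ 2 * ρ
      ≤ (Measure.pi fun _ : κ => unitUniform).real (circSeparated κ ρ) := by
  classical
  have hsub : (circSeparated κ ρ)ᶜ ⊆
      ⋃ p : κ × κ, if p.2 ≠ p.1 then {a | Int.fract (a p.2 - a p.1) < ρ} else ∅ := by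
    intro a ha
    simp only [circSeparated, Set.mem_compl_iff, Set.mem_ofPred_eq, not_forall, not_le] at ha
    obtain ⟨i, j, hij, h⟩ := ha
    refine Set.mem_iUnion.2 ⟨(i, j), ?_⟩
    rw [if_pos hij]
    exact h
  have hle : (Measure.pi fun _ : κ => unitUniform).real (circSeparated κ ρ)ᶜ
      ≤ (Fintype.card κ : ℝ) ^ 2 * ρ := by
    refine (measureReal_mono hsub).trans <| (measureReal_iUnion_fintype_le _).trans ?_
    calc _ ≤ ∑ _p : κ × κ, ρ := by
          refine Finset.sum_le_sum fun p _ => ?_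
          split_ifs with hp
          · exact (pi_unitUniform_real_fract_sub_lt hp h0 h1).le
          · simpa using h0
      _ = _ := by simp [sq]
  rw [probReal_compl_eq_one_sub (measurableSet_circSeparated κ ρ)] at hle
  linarith

/-- The event that no other point lies in the arc of length `ρ` starting at `x i`. -/
def arcEmpty {ι : Type*} (ρ : ℝ) (i : ι) : Set (ι → ℝ) :=
  {x | ∀ j, j ≠ i → ρ ≤ Int.fract (x j - x i)}

lemma measurableSet_arcEmpty {ι : Type*} [Fintype ι] (ρ : ℝ) (i : ι) :
    MeasurableSet (arcEmpty ρ i) := by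
  have : arcEmpty ρ i = ⋂ j, ⋂ _ : j ≠ i, {x | ρ ≤ Int.fract (x j - x i)} := by
    ext x
    simp [arcEmpty]
  rw [this]
  exact MeasurableSet.iInter fun j => MeasurableSet.iInter fun _ =>
    measurableSet_le measurable_const (by fun_prop)

lemma pi_unitUniform_real_iInter_arcEmpty {ι : Type*} [Fintype ι] (S : Finset ι) {ρ : ℝ}
    (h0 : 0 ≤ ρ) (h1 : ρ ≤ 1) :
    (Measure.pi fun _ : ι => unitUniform).real (⋂ i ∈ S, arcEmpty ρ i)
      = (1 - S.card * ρ) ^ (Fintype.card ι - S.card) *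
        (Measure.pi fun _ : S => unitUniform).real (circSeparated S ρ) := by
  classical
  let G : Set ((S → ℝ) × ({i // i ∉ S} → ℝ)) :=
    {p | p.1 ∈ circSeparated S ρ ∧ ∀ l i, ρ ≤ Int.fract (p.2 l - p.1 i)}
  have hG : MeasurableSet G := by
    have : G = Prod.fst ⁻¹' circSeparated S ρ ∩ 
        ⋂ l, ⋂ i, {p : (S → ℝ) × ({i // i ∉ S} → ℝ) | ρ ≤ Int.fract (p.2 l - p.1 i)} := by
      ext p
      simp [G]
    rw [this]
    refine (measurable_fst (measurableSet_circSeparated S ρ)).inter ?_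
    exact MeasurableSet.iInter fun l => MeasurableSet.iInter fun i =>
      measurableSet_le measurable_const (by fun_prop)
  have hpre : (⋂ i ∈ S, arcEmpty ρ i)
      = MeasurableEquiv.piEquivPiSubtypeProd (fun _ : ι => ℝ) (· ∈ S) ⁻¹' G := by
    ext x
    simp only [Set.mem_iInter, arcEmpty, Set.mem_ofPred_eq, Set.mem_preimage, G, circSeparated,
      MeasurableEquiv.piEquivPiSubtypeProd, MeasurableEquiv.coe_mk,
      Equiv.piEquivPiSubtypeProd_apply]
    constructor
    · intro h
      exact ⟨fun i j hij => h i i.2 j fun hc => hij (Subtype.ext hc),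
        fun l i => h i i.2 l fun hc => l.2 (hc ▸ i.2)⟩
    · rintro ⟨hs, hc⟩ i hi j hij
      by_cases hj : j ∈ S
      · exact hs ⟨i, hi⟩ ⟨j, hj⟩ fun he => hij (congrArg Subtype.val he)
      · exact hc ⟨j, hj⟩ ⟨i, hi⟩
  have hfib (a : S → ℝ) : (Measure.pi fun _ : {i // i ∉ S} => unitUniform) (Prod.mk a ⁻¹' G)
      = (circSeparated S ρ).indicator
        (fun _ => ENNReal.ofReal ((1 - S.card * ρ) ^ (Fintype.card ι - S.card))) a := by
    by_cases ha : a ∈ circSeparated S ρ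
    · have hset : Prod.mk a ⁻¹' G = Set.univ.pi fun _ => {y | ∀ i, ρ ≤ Int.fract (y - a i)} := by
        ext y
        simp [G, ha]
      have hreal := unitUniform_real_forall_le_fract_sub h0 h1 ha
      rw [Fintype.card_coe] at hreal
      rw [Set.indicator_of_mem ha, hset, Measure.pi_pi, Finset.prod_const, Finset.card_univ,
        ENNReal.ofReal_pow (hreal ▸ measureReal_nonneg), ← hreal, ofReal_measureReal,
        Fintype.card_subtype_compl, Fintype.card_coe]
    · have hset : Prod.mk a ⁻¹' G = ∅ := by
        ext y
        simp [G, ha]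
      rw [Set.indicator_of_notMem ha, hset, measure_empty]
  have hpow : (ENNReal.ofReal ((1 - S.card * ρ) ^ (Fintype.card ι - S.card))).toReal *
        (Measure.pi fun _ : S => unitUniform).real (circSeparated S ρ)
      = (1 - S.card * ρ) ^ (Fintype.card ι - S.card) *
        (Measure.pi fun _ : S => unitUniform).real (circSeparated S ρ) := by
    rcases (circSeparated S ρ).eq_empty_or_nonempty with h | ⟨a, ha⟩
    · simp [h]
    · have hreal := unitUniform_real_forall_le_fract_sub h0 h1 ha
      rw [Fintype.card_coe] at hreal
      rw [ENNReal.toReal_ofReal (pow_nonneg (hreal ▸ measureReal_nonneg) _)]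
  rw [hpre, measureReal_def, (measurePreserving_piEquivPiSubtypeProd (fun _ : ι => unitUniform)
    (· ∈ S)).measure_preimage_equiv, Measure.prod_apply hG]
  simp_rw [hfib]
  rw [lintegral_indicator_const (measurableSet_circSeparated S ρ), ENNReal.toReal_mul,
    ← measureReal_def]
  convert hpow

lemma card_circGap_eq_card_arcEmpty {n : ℕ} (hn : 2 ≤ n) {x : Fin n → ℝ}
    (hinj : Function.Injective x) (hx : ∀ i, x i ∈ Set.Ico (0 : ℝ) 1) (ρ : ℝ) :
    Nat.card {i : Fin n // ρ ≤ circGap x i} = Nat.card {i // x ∈ arcEmpty ρ i} := by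
  set σ := Tuple.sort x with hσ
  have hmono : StrictMono (sortedCoords x) :=
    (Tuple.monotone_sort x).strictMono_of_injective (hinj.comp σ.injective)
  have hmem (i : Fin n) : 0 ≤ sortedCoords x i ∧ sortedCoords x i < 1 := hx (σ i)
  have hfract (i l : Fin n) : Int.fract (x (σ l) - x (σ i)) =
      if i ≤ l then sortedCoords x l - sortedCoords x i
      else sortedCoords x l - sortedCoords x i + 1 := by
    rw [fract_sub_of_mem_Ico (hx _) (hx _)]
    exact if_congr hmono.le_iff_le rfl rfl
  refine Nat.card_congr (σ.subtypeEquiv fun i => ?_)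
  have harc : x ∈ arcEmpty ρ (σ i) ↔ ∀ l, l ≠ i → ρ ≤ Int.fract (x (σ l) - x (σ i)) := by
    constructor
    · exact fun h l hl => h (σ l) (σ.injective.ne hl)
    · intro h j hj
      have := h (σ.symm j) fun he => hj (by rw [← he, Equiv.apply_symm_apply])
      rwa [Equiv.apply_symm_apply] at this
  simp_rw [harc, hfract]
  unfold circGap
  split_ifs with hi
  · constructor
    · intro h l hl
      split_ifs with hil
      · have hle : (⟨i + 1, hi⟩ : Fin n) ≤ l := by
          have : i < l := lt_of_le_of_ne hil hl.symm
          exact this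
        linarith [hmono.monotone hle]
      · linarith [(hmem ⟨i + 1, hi⟩).2, (hmem l).1]
    · intro h
      have hlt : i < (⟨i + 1, hi⟩ : Fin n) := Nat.lt_succ_self _
      have := h _ hlt.ne'
      rwa [if_pos hlt.le] at this
  · constructor
    · intro h l hl
      have hil : ¬ i ≤ l := by
        intro hle
        have : i < l := lt_of_le_of_ne hle hl.symm
        have := l.isLt
        omega
      rw [if_neg hil]
      have h0 : (⟨0, i.pos⟩ : Fin n) ≤ l := Nat.zero_le _
      linarith [hmono.monotone h0]
    · intro h
      have hlt : (⟨0, i.pos⟩ : Fin n) < i := by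
        rw [Fin.lt_def]
        change 0 < (i : ℕ)
        omega
      have := h _ hlt.ne
      rw [if_neg hlt.not_ge] at this
      linarith

lemma volume_restrict_unitBox (n : ℕ) :
    (volume : Measure (Fin n → ℝ)).restrict (unitBox n)
      = Measure.pi fun _ : Fin n => unitUniform := by
  rw [volume_pi, unitBox, Measure.restrict_pi_pi]
  simp_rw [unitUniform, Measure.restrict_congr_set Ico_ae_eq_Icc]

lemma ae_pi_unitUniform_mem_Ico {ι : Type*} [Fintype ι] :
    ∀ᵐ x ∂(Measure.pi fun _ : ι => unitUniform), ∀ i, x i ∈ Set.Ico (0 : ℝ) 1 := by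
  rw [ae_all_iff]
  intro i
  exact (measurePreserving_eval (fun _ : ι => unitUniform) i).quasiMeasurePreserving.ae
    (ae_restrict_mem measurableSet_Ico)

lemma ae_pi_unitUniform_injective {ι : Type*} [Fintype ι] :
    ∀ᵐ x ∂(Measure.pi fun _ : ι => unitUniform), Function.Injective x := by
  have hne : ∀ i j : ι, j ≠ i → ∀ᵐ x ∂(Measure.pi fun _ : ι => unitUniform), x j ≠ x i := by
    intro i j hij
    rw [ae_iff, ← measureReal_eq_zero_iff]
    refine le_antisymm (le_of_forall_pos_le_add fun ε hε => ?_) measureReal_nonneg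
    have hε' : 0 < min ε 1 := lt_min hε one_pos
    have hsub : {x : ι → ℝ | ¬ x j ≠ x i} ⊆ {x | Int.fract (x j - x i) < min ε 1} := by
      intro x hx
      have hx' : x j = x i := not_not.1 hx
      simpa [hx'] using hε
    have := measureReal_mono (μ := Measure.pi fun _ : ι => unitUniform) hsub
    rw [pi_unitUniform_real_fract_sub_lt hij hε'.le (min_le_right _ _)] at this
    linarith [min_le_left ε 1]
  have hall : ∀ᵐ x ∂(Measure.pi fun _ : ι => unitUniform), ∀ i j : ι, j ≠ i → x j ≠ x i := by
    simp_rw [ae_all_iff]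
    exact hne
  filter_upwards [hall] with x hx j i hji
  by_contra h
  exact hx i j h hji

lemma P_discPB_eq {n : ℕ} (hn : 2 ≤ n) (ρ : ℝ) (k : ℕ) :
    P_discPB n ρ k = (Measure.pi fun _ : Fin n => unitUniform).real
      {x | Nat.card {i // x ∈ arcEmpty ρ i} = k} := by
  have hbox : MeasurableSet (unitBox n) := MeasurableSet.univ_pi fun _ => measurableSet_Icc
  have hset : discPB n ρ k = {x | Nat.card {i : Fin n // ρ ≤ circGap x i} = k} ∩ unitBox n := by
    ext x
    exact and_comm
  rw [P_discPB, hset, ← Measure.restrict_apply' hbox, volume_restrict_unitBox, measureReal_def]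
  congr 1
  refine measure_congr ?_
  filter_upwards [ae_pi_unitUniform_mem_Ico, ae_pi_unitUniform_injective] with x hx hinj
  exact congrArg (· = k) (card_circGap_eq_card_arcEmpty hn hinj hx ρ)

lemma tendsto_sum_pi_unitUniform_real_iInter_arcEmpty {ρ : ℕ → ℝ} (hρ : ∀ n, 0 < ρ n) {η : ℝ}
    (h : Tendsto (fun n : ℕ => (n : ℝ) * ρ n - Real.log n) atTop (nhds η)) (j : ℕ) :
    Tendsto (fun n : ℕ => ∑ S ∈ Finset.powersetCard j (Finset.univ : Finset (Fin n)),
      (Measure.pi fun _ : Fin n => unitUniform).real (⋂ i ∈ S, arcEmpty (ρ n) i)) atTop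
      (nhds (Real.exp (-η) ^ j / j.factorial)) := by
  have hρ0 := tendsto_zero_of_natCast_mul_sub_log h
  have hlim := tendsto_choose_mul_one_sub_pow h j
  have hfac : Tendsto (fun n => 1 - (j : ℝ) ^ 2 * ρ n) atTop (nhds 1) := by
    simpa using (hρ0.const_mul ((j : ℝ) ^ 2)).const_sub 1
  have hlow := hlim.mul hfac
  rw [mul_one] at hlow
  have hj : ∀ᶠ n in atTop, (j : ℝ) * ρ n < 1 := by
    have := hρ0.const_mul (j : ℝ)
    rw [mul_zero] at this
    exact this.eventually_lt_const one_pos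
  have hone : ∀ᶠ n in atTop, ρ n < 1 := hρ0.eventually_lt_const one_pos
  refine tendsto_of_tendsto_of_tendsto_of_le_of_le' hlow hlim ?_ ?_
  · filter_upwards [hj, hone] with n hjn h1
    have hcard : ((n.choose j : ℕ) : ℝ)
        = ∑ _S ∈ Finset.powersetCard j (Finset.univ : Finset (Fin n)), (1 : ℝ) := by simp
    rw [hcard, mul_assoc, Finset.sum_mul]
    refine Finset.sum_le_sum fun S hS => ?_
    have hSj := (Finset.mem_powersetCard.1 hS).2
    have hsep := one_sub_le_pi_unitUniform_real_circSeparated S (hρ n).le h1.le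
    rw [Fintype.card_coe, hSj] at hsep
    rw [pi_unitUniform_real_iInter_arcEmpty S (hρ n).le h1.le, hSj, Fintype.card_fin, one_mul]
    exact mul_le_mul_of_nonneg_left hsep (pow_nonneg (by linarith) _)
  · filter_upwards [hj, hone] with n hjn h1
    have hcard : ((n.choose j : ℕ) : ℝ)
        = ∑ _S ∈ Finset.powersetCard j (Finset.univ : Finset (Fin n)), (1 : ℝ) := by simp
    rw [hcard, Finset.sum_mul]
    refine Finset.sum_le_sum fun S hS => ?_
    have hSj := (Finset.mem_powersetCard.1 hS).2
    rw [pi_unitUniform_real_iInter_arcEmpty S (hρ n).le h1.le, hSj, Fintype.card_fin, one_mul]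
    exact mul_le_of_le_one_right (pow_nonneg (by linarith) _) measureReal_le_one

/-- if `n·ρ_n − ln n → η`, then the probability that the MANET with periodic
boundary conditions is disconnected at exactly `k` places converges to the Poisson
probability `(e^{−ηk}/k!)·exp(−e^{−η})`. -/
theorem P_discPB_asymptotic (ρ : ℕ → ℝ) (hρ : ∀ n, 0 < ρ n) (η : ℝ)
    (h : Tendsto (fun n : ℕ => (n : ℝ) * ρ n - Real.log n) atTop (nhds η)) (k : ℕ) :
    Tendsto (fun n : ℕ => P_discPB n (ρ n) k) atTop
      (nhds (Real.exp (-η * k) / (Nat.factorial k : ℝ) * Real.exp (-Real.exp (-η)))) := by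
  have hmain := tendsto_poisson_of_bonferroni (k := k)
    (p := fun n => (Measure.pi fun _ : Fin n => unitUniform).real
      {x | Nat.card {i // x ∈ arcEmpty (ρ n) i} = k})
    (B := fun n j => ∑ S ∈ Finset.powersetCard j (Finset.univ : Finset (Fin n)),
      (Measure.pi fun _ : Fin n => unitUniform).real (⋂ i ∈ S, arcEmpty (ρ n) i))
    (fun M n => abs_measureReal_card_eq_sub_sum_le (Measure.pi fun _ : Fin n => unitUniform)
      (measurableSet_arcEmpty (ρ n)) k M)
    (tendsto_sum_pi_unitUniform_real_iInter_arcEmpty hρ h)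
  rw [← Real.exp_nat_mul, mul_comm (k : ℝ)] at hmain
  refine hmain.congr' ?_
  filter_upwards [eventually_ge_atTop 2] with n hn
  exact (P_discPB_eq hn (ρ n) k).symm
end

section
/- Let (ρ_n) be a sequence of positive reals such that n·ρ_n − ln n → +∞ as n → ∞. Then the probability of connectedness of the 1-dimensional MANET with periodic boundary conditions satisfies P_{CONN-PB}(n, ρ_n) → 1 as n → ∞. -/
open MeasureTheory Filter

/-- The points of `[0,1]` outside the circular arc of length `ρ` that starts at `t`. -/
def arcCompl (ρ t : ℝ) : Set ℝ := Set.Icc (max 0 (t + ρ - 1)) t ∪ Set.Icc (t + ρ) 1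

/-- The points of the unit box for which no coordinate other than the `j`-th one lies in the
circular arc of length `ρ` that starts at the `j`-th coordinate. -/
def isolatedCoord {n : ℕ} (ρ : ℝ) (j : Fin n) : Set (Fin n → ℝ) :=
  {x | x j ∈ Set.Icc (0 : ℝ) 1 ∧ ∀ k, k ≠ j → x k ∈ arcCompl ρ (x j)}

lemma volume_arcCompl_le {ρ t : ℝ} (ht : t ∈ Set.Icc (0 : ℝ) 1) :
    volume (arcCompl ρ t) ≤ ENNReal.ofReal (1 - ρ) := by
  obtain ⟨h0, h1⟩ := ht
  refine (measure_union_le _ _).trans ?_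
  rw [Real.volume_Icc, Real.volume_Icc]
  rcases le_total (t + ρ) 1 with h | h
  · rw [max_eq_left (by linarith), ← ENNReal.ofReal_add (by linarith) (by linarith)]
    exact ENNReal.ofReal_le_ofReal (by linarith)
  · rw [max_eq_right (by linarith), ENNReal.ofReal_of_nonpos (p := 1 - (t + ρ)) (by linarith),
      add_zero]
    exact ENNReal.ofReal_le_ofReal (by linarith)

lemma volume_isolatedCoord_le {m : ℕ} (ρ : ℝ) (j : Fin (m + 1)) :
    volume (isolatedCoord ρ j) ≤ ENNReal.ofReal (1 - ρ) ^ m := by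
  set T : Set (ℝ × (Fin m → ℝ)) :=
    {p | p.1 ∈ Set.Icc (0 : ℝ) 1 ∧ ∀ k, p.2 k ∈ arcCompl ρ p.1} with hT
  have hTclosed : IsClosed T := by
    simp only [hT, arcCompl, Set.mem_union, Set.mem_Icc, Set.ofPred_and, Set.ofPred_forall,
      Set.ofPred_or]
    refine IsClosed.inter (IsClosed.inter ?_ ?_) (isClosed_iInter fun k =>
      IsClosed.union (IsClosed.inter ?_ ?_) (IsClosed.inter ?_ ?_))
    all_goals exact isClosed_le (by fun_prop) (by fun_prop)
  have hpre : isolatedCoord ρ j = MeasurableEquiv.piFinSuccAbove (fun _ => ℝ) j ⁻¹' T := by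
    ext x
    simp only [isolatedCoord, hT, Set.mem_ofPred_eq, Set.mem_preimage,
      MeasurableEquiv.piFinSuccAbove_apply, Fin.insertNthEquiv_symm_apply, Fin.removeNth]
    refine and_congr_right fun _ => ⟨fun h k => h _ (Fin.succAbove_ne j k), fun h k hk => ?_⟩
    obtain ⟨l, rfl⟩ := Fin.exists_succAbove_eq hk
    exact h l
  rw [hpre, (volume_preserving_piFinSuccAbove (fun _ => ℝ) j).measure_preimage
    hTclosed.measurableSet.nullMeasurableSet, Measure.volume_eq_prod,
    Measure.prod_apply hTclosed.measurableSet]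
  calc ∫⁻ t, volume (Prod.mk t ⁻¹' T)
      ≤ ∫⁻ t, (Set.Icc (0 : ℝ) 1).indicator (fun _ => ENNReal.ofReal (1 - ρ) ^ m) t := by
        refine lintegral_mono fun t => ?_
        by_cases ht : t ∈ Set.Icc (0 : ℝ) 1
        · have hsec : Prod.mk t ⁻¹' T = Set.univ.pi fun _ : Fin m => arcCompl ρ t := by
            ext y
            simp only [hT, Set.mem_preimage, Set.mem_ofPred_eq, Set.mem_univ_pi, ht, true_and]
          rw [Set.indicator_of_mem ht, hsec, volume_pi_pi, Finset.prod_const, Finset.card_univ,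
            Fintype.card_fin]
          gcongr
          exact volume_arcCompl_le ht
        · have hsec : Prod.mk t ⁻¹' T = ∅ :=
            Set.eq_empty_of_forall_notMem fun y hy => ht hy.1
          rw [hsec, measure_empty]
          exact zero_le
    _ = ENNReal.ofReal (1 - ρ) ^ m := by
        rw [lintegral_indicator_const measurableSet_Icc, Real.volume_Icc]
        simp

lemma mem_isolatedCoord_of_le_circGap {n : ℕ} {ρ : ℝ} {x : Fin n → ℝ} (hx : x ∈ unitBox n)
    {i : Fin n} (hi : ρ ≤ circGap x i) : x ∈ isolatedCoord ρ (Tuple.sort x i) := by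
  have hbox : ∀ k, x k ∈ Set.Icc (0 : ℝ) 1 := fun k => hx k (Set.mem_univ k)
  have hmono : Monotone (sortedCoords x) := Tuple.monotone_sort x
  refine ⟨hbox _, fun k hk => ?_⟩
  obtain ⟨l, rfl⟩ := (Tuple.sort x).surjective k
  have hl : l ≠ i := fun h => hk (h ▸ rfl)
  change sortedCoords x l ∈ arcCompl ρ (sortedCoords x i)
  have hl01 : sortedCoords x l ∈ Set.Icc (0 : ℝ) 1 := hbox _
  rcases lt_or_gt_of_ne hl with hlt | hgt
  · refine Or.inl ⟨max_le hl01.1 ?_, hmono hlt.le⟩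
    unfold circGap at hi
    split_ifs at hi with h
    · have h1 : sortedCoords x ⟨i + 1, h⟩ ≤ 1 := (hbox _).2
      linarith [hl01.1]
    · have h0 : sortedCoords x ⟨0, i.pos⟩ ≤ sortedCoords x l := hmono (Nat.zero_le _)
      linarith
  · have h : (i : ℕ) + 1 < n := lt_of_le_of_lt hgt l.isLt
    rw [circGap, dif_pos h] at hi
    have h1 : sortedCoords x ⟨i + 1, h⟩ ≤ sortedCoords x l := hmono hgt
    exact Or.inr ⟨by linarith, hl01.2⟩

lemma volume_unitBox (n : ℕ) : volume (unitBox n) = 1 := by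
  rw [unitBox, volume_pi_pi]
  simp

lemma P_connPB_le_one (n : ℕ) (ρ : ℝ) : P_connPB n ρ ≤ 1 := by
  have h : volume (connPB n ρ) ≤ 1 :=
    (measure_mono fun x hx => hx.1).trans (volume_unitBox n).le
  simpa [P_connPB] using ENNReal.toReal_mono ENNReal.one_ne_top h

lemma one_sub_le_P_connPB (m : ℕ) (ρ : ℝ) :
    1 - (m + 1 : ℕ) * max (1 - ρ) 0 ^ m ≤ P_connPB (m + 1) ρ := by
  have hcover : unitBox (m + 1) ⊆
      connPB (m + 1) ρ ∪ ⋃ j : Fin (m + 1), isolatedCoord ρ j := by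
    intro x hx
    by_cases hc : ∀ i, circGap x i < ρ
    · exact Or.inl ⟨hx, hc⟩
    · push Not at hc
      obtain ⟨i, hi⟩ := hc
      exact Or.inr (Set.mem_iUnion.2 ⟨_, mem_isolatedCoord_of_le_circGap hx hi⟩)
  have hbad : volume (⋃ j : Fin (m + 1), isolatedCoord ρ j) ≤
      (m + 1 : ℕ) * ENNReal.ofReal (1 - ρ) ^ m := by
    refine (measure_iUnion_fintype_le _ _).trans ?_
    refine (Finset.sum_le_sum fun j _ => volume_isolatedCoord_le ρ j).trans ?_
    simp
  have hconn : volume (connPB (m + 1) ρ) ≠ ⊤ :=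
    ne_top_of_le_ne_top (by simp [volume_unitBox])
      (measure_mono fun x (hx : x ∈ connPB (m + 1) ρ) => hx.1 :
        volume (connPB (m + 1) ρ) ≤ volume (unitBox (m + 1)))
  have hfin : ((m + 1 : ℕ) : ENNReal) * ENNReal.ofReal (1 - ρ) ^ m ≠ ⊤ :=
    ENNReal.mul_ne_top (ENNReal.natCast_ne_top _) (ENNReal.pow_ne_top ENNReal.ofReal_ne_top)
  have htotal : (1 : ENNReal) ≤
      volume (connPB (m + 1) ρ) + (m + 1 : ℕ) * ENNReal.ofReal (1 - ρ) ^ m := by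
    rw [← volume_unitBox (m + 1)]
    exact (measure_mono hcover).trans ((measure_union_le _ _).trans (by gcongr))
  have hreal := ENNReal.toReal_mono (ENNReal.add_ne_top.2 ⟨hconn, hfin⟩) htotal
  rw [ENNReal.toReal_add hconn hfin, ENNReal.toReal_mul, ENNReal.toReal_pow,
    ENNReal.toReal_natCast, ENNReal.toReal_ofReal', ENNReal.toReal_one] at hreal
  unfold P_connPB
  linarith

lemma natCast_mul_pow_le_exp {m : ℕ} (hm : m ≠ 0) (ρ : ℝ) :
    ((m + 1 : ℕ) : ℝ) * max (1 - ρ) 0 ^ m ≤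
      Real.exp (1 - ((m + 1 : ℕ) * ρ - Real.log (m + 1 : ℕ))) := by
  rcases le_total ρ 1 with h | h
  · have hbase : max (1 - ρ) 0 ≤ Real.exp (-ρ) :=
      max_le (Real.one_sub_le_exp_neg ρ) (Real.exp_nonneg _)
    calc ((m + 1 : ℕ) : ℝ) * max (1 - ρ) 0 ^ m
        ≤ Real.exp (Real.log (m + 1 : ℕ)) * Real.exp (-ρ) ^ m := by
          rw [Real.exp_log (by positivity)]
          gcongr
      _ = Real.exp (Real.log (m + 1 : ℕ) + m * -ρ) := by
          rw [← Real.exp_nat_mul, ← Real.exp_add]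
      _ ≤ _ := by
          gcongr
          push_cast
          linarith
  · rw [max_eq_right (by linarith), zero_pow hm, mul_zero]
    exact Real.exp_nonneg _

/-- if `n·ρ_n − ln n → +∞`, then the probability of connectedness with
periodic boundary conditions tends to `1`. -/
theorem P_connPB_tendsto_one (ρ : ℕ → ℝ) (hρ : ∀ n, 0 < ρ n)
    (h : Tendsto (fun n : ℕ => (n : ℝ) * ρ n - Real.log n) atTop atTop) :
    Tendsto (fun n : ℕ => P_connPB n (ρ n)) atTop (nhds 1) := by
  have hexp : Tendsto
      (fun n : ℕ => 1 - Real.exp (1 - ((n : ℝ) * ρ n - Real.log n))) atTop (nhds 1) := by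
    have := (Real.tendsto_exp_atBot.comp (tendsto_atBot_add_const_left atTop 1
      (tendsto_neg_atTop_atBot.comp h))).const_sub 1
    simpa [sub_eq_add_neg] using this
  refine tendsto_of_tendsto_of_tendsto_of_le_of_le' hexp tendsto_const_nhds ?_
    (Eventually.of_forall fun n => P_connPB_le_one n (ρ n))
  filter_upwards [eventually_ge_atTop 2] with n hn
  obtain ⟨m, rfl⟩ : ∃ m, n = m + 1 := ⟨n - 1, by omega⟩
  have h1 := one_sub_le_P_connPB m (ρ (m + 1))
  have h2 := natCast_mul_pow_le_exp (m := m) (by omega) (ρ (m + 1))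
  linarith
end

section
/- Let (ρ_n) be a sequence of positive reals such that n·ρ_n − ln n → −∞ as n → ∞. Then the probability of connectedness of the 1-dimensional MANET with periodic boundary conditions satisfies P_{CONN-PB}(n, ρ_n) → 0 as n → ∞. -/
open MeasureTheory Filter

theorem pi_apply_eq_lintegral_insertNth {n : ℕ} (ν : Measure ℝ) [SigmaFinite ν]
    (i : Fin (n + 1)) {E : Set (Fin (n + 1) → ℝ)} (hE : MeasurableSet E) :
    Measure.pi (fun _ => ν) E =
      ∫⁻ t, Measure.pi (fun _ : Fin n => ν) {y | i.insertNth t y ∈ E} ∂ν := by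
  have h := (measurePreserving_piFinSuccAbove (fun _ : Fin (n + 1) => ν) i).symm
  rw [← h.measure_preimage hE.nullMeasurableSet,
    Measure.prod_apply ((MeasurableEquiv.measurable _) hE)]
  rfl

/-- The uniform distribution on `[0,1]`. -/
noncomputable abbrev unifIcc : Measure ℝ := volume.restrict (Set.Icc (0 : ℝ) 1)

instance : IsProbabilityMeasure unifIcc := ⟨by simp⟩

theorem measurableSet_fract_lt (t ρ : ℝ) : MeasurableSet {u : ℝ | Int.fract (u - t) < ρ} :=
  measurableSet_lt (by fun_prop) measurable_const

theorem unifIcc_fract_lt (t : ℝ) {ρ : ℝ} (hρ1 : ρ ≤ 1) :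
    unifIcc {u : ℝ | Int.fract (u - t) < ρ} = ENNReal.ofReal ρ := by
  have hm := measurableSet_fract_lt t ρ
  have hp : Function.Periodic (fun u : ℝ => Int.fract (u - t)) 1 := by
    intro u
    simp [add_sub_right_comm]
  rw [unifIcc, ← restrict_Ioc_eq_restrict_Icc, Measure.restrict_apply hm]
  have h := (isAddFundamentalDomain_Ioc (one_pos : (0 : ℝ) < 1) 0).measure_set_eq
    (isAddFundamentalDomain_Ioc (one_pos : (0 : ℝ) < 1) t) hm (by
      rintro ⟨g, k, rfl⟩
      ext u
      simp [AddSubgroup.vadd_def, add_sub_assoc, Int.fract_intCast_add])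
  rw [zero_add] at h
  rw [h, ← Measure.restrict_apply hm, restrict_Ioc_eq_restrict_Icc, ← restrict_Ico_eq_restrict_Icc,
    Measure.restrict_apply hm]
  have : {u : ℝ | Int.fract (u - t) < ρ} ∩ Set.Ico t (t + 1) = Set.Ico t (t + ρ) := by
    ext u
    simp only [Set.mem_inter_iff, Set.mem_ofPred_eq, Set.mem_Ico]
    constructor
    · rintro ⟨h1, h2, h3⟩
      rw [Int.fract_eq_self.2 ⟨by linarith, by linarith⟩] at h1
      exact ⟨h2, by linarith⟩
    · rintro ⟨h1, h2⟩
      rw [Int.fract_eq_self.2 ⟨by linarith, by linarith⟩]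
      exact ⟨by linarith, h1, by linarith⟩
  rw [this, Real.volume_Ico, add_sub_cancel_left]

theorem unifIcc_le_fract (t : ℝ) {ρ : ℝ} (hρ0 : 0 ≤ ρ) (hρ1 : ρ ≤ 1) :
    unifIcc {u : ℝ | ρ ≤ Int.fract (u - t)} = ENNReal.ofReal (1 - ρ) := by
  have : {u : ℝ | ρ ≤ Int.fract (u - t)} = {u : ℝ | Int.fract (u - t) < ρ}ᶜ := by
    ext u; simp
  rw [this, prob_compl_eq_one_sub (measurableSet_fract_lt t ρ), unifIcc_fract_lt t hρ1,
    ENNReal.ofReal_sub _ hρ0, ENNReal.ofReal_one]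

theorem fract_sub_eq_of_le {a b c : ℝ} (h : Int.fract (c - b) ≤ Int.fract (c - a)) :
    Int.fract (b - a) = Int.fract (c - a) - Int.fract (c - b) := by
  rw [Int.fract_eq_iff]
  refine ⟨by linarith, by linarith [Int.fract_nonneg (c - b), Int.fract_lt_one (c - a)],
    ⌊c - a⌋ - ⌊c - b⌋, ?_⟩
  simp only [Int.fract]
  push_cast
  ring

theorem unifIcc_le_fract_inter {s t ρ : ℝ} (hρ0 : 0 ≤ ρ) (hρ1 : ρ ≤ 1)
    (hst : ρ ≤ Int.fract (s - t)) (hts : ρ ≤ Int.fract (t - s)) :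
    unifIcc {u : ℝ | ρ ≤ Int.fract (u - t) ∧ ρ ≤ Int.fract (u - s)} =
      ENNReal.ofReal (1 - 2 * ρ) := by
  have : {u : ℝ | ρ ≤ Int.fract (u - t) ∧ ρ ≤ Int.fract (u - s)} =
      ({u : ℝ | Int.fract (u - t) < ρ} ∪ {u : ℝ | Int.fract (u - s) < ρ})ᶜ := by
    ext u; simp
  have hd : Disjoint {u : ℝ | Int.fract (u - t) < ρ} {u : ℝ | Int.fract (u - s) < ρ} := by
    rw [Set.disjoint_left]
    intro u (h1 : Int.fract (u - t) < ρ) (h2 : Int.fract (u - s) < ρ)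
    rcases le_total (Int.fract (u - s)) (Int.fract (u - t)) with h | h
    · linarith [fract_sub_eq_of_le h, Int.fract_nonneg (u - s)]
    · linarith [fract_sub_eq_of_le h, Int.fract_nonneg (u - t)]
  rw [this, prob_compl_eq_one_sub ((measurableSet_fract_lt t ρ).union (measurableSet_fract_lt s ρ)),
    measure_union hd (measurableSet_fract_lt s ρ), unifIcc_fract_lt t hρ1, unifIcc_fract_lt s hρ1,
    ENNReal.ofReal_sub _ (by positivity), ENNReal.ofReal_one, two_mul, ENNReal.ofReal_add hρ0 hρ0]

/-- No other coordinate of `x` lies on the circular arc of length `ρ` starting at `x i`. -/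
def emptyArc {n : ℕ} (ρ : ℝ) (i : Fin n) : Set (Fin n → ℝ) :=
  {x | ∀ j, j ≠ i → ρ ≤ Int.fract (x j - x i)}

theorem measurableSet_emptyArc {n : ℕ} (ρ : ℝ) (i : Fin n) : MeasurableSet (emptyArc ρ i) := by
  simp only [emptyArc, Set.ofPred_forall]
  exact MeasurableSet.iInter fun j => MeasurableSet.iInter fun _ =>
    measurableSet_le measurable_const (by fun_prop)

theorem insertNth_mem_emptyArc {n : ℕ} {ρ : ℝ} {i : Fin (n + 1)} {t : ℝ} {y : Fin n → ℝ} :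
    (i.insertNth t y : Fin (n + 1) → ℝ) ∈ emptyArc ρ i ↔ ∀ k, ρ ≤ Int.fract (y k - t) := by
  simp [emptyArc, Fin.forall_iff_succAbove i]

theorem pi_emptyArc {n : ℕ} {ρ : ℝ} (hρ0 : 0 ≤ ρ) (hρ1 : ρ ≤ 1) (i : Fin (n + 1)) :
    Measure.pi (fun _ => unifIcc) (emptyArc ρ i) = ENNReal.ofReal (1 - ρ) ^ n := by
  have key : ∀ t : ℝ, Measure.pi (fun _ : Fin n => unifIcc)
      {y | (i.insertNth t y : Fin (n + 1) → ℝ) ∈ emptyArc ρ i} = ENNReal.ofReal (1 - ρ) ^ n := by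
    intro t
    have : {y | (i.insertNth t y : Fin (n + 1) → ℝ) ∈ emptyArc ρ i} =
        Set.univ.pi fun _ : Fin n => {u : ℝ | ρ ≤ Int.fract (u - t)} := by
      ext y
      simp [insertNth_mem_emptyArc]
    rw [this, Measure.pi_pi]
    simp [unifIcc_le_fract t hρ0 hρ1, -Measure.restrict_apply']
  rw [pi_apply_eq_lintegral_insertNth _ i (measurableSet_emptyArc ρ i)]
  simp_rw [key]
  simp

theorem pi_emptyArc_inter_le {n : ℕ} {ρ : ℝ} (hρ0 : 0 ≤ ρ) (hρ1 : ρ ≤ 1) {i j : Fin (n + 2)}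
    (hij : j ≠ i) :
    Measure.pi (fun _ => unifIcc) (emptyArc ρ i ∩ emptyArc ρ j) ≤
      ENNReal.ofReal (1 - 2 * ρ) ^ n := by
  obtain ⟨j, rfl⟩ := Fin.exists_succAbove_eq hij
  have hm := (measurableSet_emptyArc ρ i).inter (measurableSet_emptyArc ρ (i.succAbove j))
  have key : ∀ t s : ℝ, Measure.pi (fun _ : Fin n => unifIcc)
      {z | (i.insertNth t (j.insertNth s z : Fin (n + 1) → ℝ) : Fin (n + 2) → ℝ) ∈
        emptyArc ρ i ∩ emptyArc ρ (i.succAbove j)} ≤ ENNReal.ofReal (1 - 2 * ρ) ^ n := by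
    intro t s
    have hmem : ∀ z : Fin n → ℝ,
        (i.insertNth t (j.insertNth s z : Fin (n + 1) → ℝ) : Fin (n + 2) → ℝ) ∈
          emptyArc ρ i ∩ emptyArc ρ (i.succAbove j) →
        ρ ≤ Int.fract (s - t) ∧ ρ ≤ Int.fract (t - s) ∧
          ∀ k, ρ ≤ Int.fract (z k - t) ∧ ρ ≤ Int.fract (z k - s) := by
      rintro z ⟨h1, h2⟩
      rw [insertNth_mem_emptyArc] at h1
      refine ⟨by simpa using h1 j, by simpa using h2 i (Fin.succAbove_ne i j).symm, fun k =>
        ⟨by simpa using h1 (j.succAbove k), ?_⟩⟩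
      simpa using h2 (i.succAbove (j.succAbove k)) (by simp)
    by_cases hst : ρ ≤ Int.fract (s - t) ∧ ρ ≤ Int.fract (t - s)
    · refine (measure_mono (t := Set.univ.pi fun _ : Fin n =>
        {u : ℝ | ρ ≤ Int.fract (u - t) ∧ ρ ≤ Int.fract (u - s)})
          fun z hz k _ => (hmem z hz).2.2 k).trans ?_
      rw [Measure.pi_pi]
      simp [unifIcc_le_fract_inter hρ0 hρ1 hst.1 hst.2, -Measure.restrict_apply']
    · refine (measure_mono (t := ∅) fun z hz =>
        (hst ⟨(hmem z hz).1, (hmem z hz).2.1⟩).elim).trans (by simp)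
  rw [pi_apply_eq_lintegral_insertNth _ i hm]
  refine (lintegral_mono (g := fun _ => ENNReal.ofReal (1 - 2 * ρ) ^ n) fun t => ?_).trans
    (by simp)
  rw [pi_apply_eq_lintegral_insertNth _ j]
  · exact (lintegral_mono (g := fun _ => ENNReal.ofReal (1 - 2 * ρ) ^ n) (key t)).trans (by simp)
  · have : Measurable fun y : Fin (n + 1) → ℝ => (i.insertNth t y : Fin (n + 2) → ℝ) := by
      fun_prop
    exact this hm

theorem sq_mul_measureReal_iInter_compl_le {Ω ι : Type*} [MeasurableSpace Ω] [Fintype ι]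
    {μ : Measure Ω} [IsProbabilityMeasure μ] {A : ι → Set Ω} (hA : ∀ i, MeasurableSet (A i))
    {p q : ℝ} (hq : 0 ≤ q) (hp : ∀ i, μ.real (A i) = p)
    (hpq : ∀ i j, j ≠ i → μ.real (A i ∩ A j) ≤ q) :
    (Fintype.card ι * p) ^ 2 * μ.real (⋂ i, (A i)ᶜ) ≤
      Fintype.card ι * p + Fintype.card ι ^ 2 * q - (Fintype.card ι * p) ^ 2 := by
  classical
  set c : ℝ := Fintype.card ι * p with hc
  set N : Set Ω := ⋂ i, (A i)ᶜ
  have hNm : MeasurableSet N := MeasurableSet.iInter fun i => (hA i).compl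
  have hint : ∀ {B : Set Ω}, MeasurableSet B → Integrable (B.indicator (1 : Ω → ℝ)) μ :=
    fun hB => (integrable_const (1 : ℝ)).indicator hB
  have hle : ∀ x, c ^ 2 * N.indicator 1 x ≤
      ∑ i, ∑ j, (A i ∩ A j).indicator (1 : Ω → ℝ) x -
        2 * c * ∑ i, (A i).indicator (1 : Ω → ℝ) x + c ^ 2 := by
    intro x
    have hsq : ∑ i, ∑ j, (A i ∩ A j).indicator (1 : Ω → ℝ) x =
        (∑ i, (A i).indicator (1 : Ω → ℝ) x) ^ 2 := by
      simp_rw [sq, Finset.sum_mul_sum, Set.inter_indicator_one, Pi.mul_apply]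
    rw [hsq]
    by_cases hx : x ∈ N
    · have h0 : ∑ i, (A i).indicator (1 : Ω → ℝ) x = 0 :=
        Finset.sum_eq_zero fun i _ => Set.indicator_of_notMem (Set.mem_iInter.1 hx i) _
      simp [h0, hx]
    · simp only [hx, not_false_eq_true, Set.indicator_of_notMem, mul_zero]
      nlinarith [sq_nonneg (∑ i, (A i).indicator (1 : Ω → ℝ) x - c)]
  have hI1 : Integrable (fun x => ∑ i, ∑ j, (A i ∩ A j).indicator (1 : Ω → ℝ) x) μ :=
    integrable_finsetSum _ fun i _ => integrable_finsetSum _ fun j _ => hint ((hA i).inter (hA j))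
  have hI2 : Integrable (fun x => 2 * c * ∑ i, (A i).indicator (1 : Ω → ℝ) x) μ :=
    (integrable_finsetSum _ fun i _ => hint (hA i)).const_mul _
  have h1 : ∫ x, ∑ i, ∑ j, (A i ∩ A j).indicator (1 : Ω → ℝ) x ∂μ =
      ∑ i, ∑ j, μ.real (A i ∩ A j) := by
    rw [integral_finsetSum _ fun i _ => integrable_finsetSum _ fun j _ =>
      hint ((hA i).inter (hA j))]
    refine Finset.sum_congr rfl fun i _ => ?_
    rw [integral_finsetSum _ fun j _ => hint ((hA i).inter (hA j))]
    exact Finset.sum_congr rfl fun j _ => integral_indicator_one ((hA i).inter (hA j))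
  have h2 : ∫ x, 2 * c * ∑ i, (A i).indicator (1 : Ω → ℝ) x ∂μ = 2 * c * c := by
    rw [integral_const_mul, integral_finsetSum _ fun i _ => hint (hA i)]
    simp [integral_indicator_one (hA _), hp, hc]
  have h3 : ∑ i, ∑ j, μ.real (A i ∩ A j) ≤ c + Fintype.card ι ^ 2 * q := by
    calc ∑ i, ∑ j, μ.real (A i ∩ A j) ≤ ∑ i : ι, ∑ j : ι, (q + if j = i then p else 0) := by
          refine Finset.sum_le_sum fun i _ => Finset.sum_le_sum fun j _ => ?_
          split_ifs with hij
          · subst hij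
            rw [Set.inter_self, hp]
            linarith
          · linarith [hpq i j hij]
      _ = c + Fintype.card ι ^ 2 * q := by
          simp [Finset.sum_add_distrib, hc]
          ring
  have h4 := integral_mono ((hint hNm).const_mul (c ^ 2)) ((hI1.sub hI2).add (integrable_const _)) hle
  rw [integral_const_mul, integral_indicator_one hNm] at h4
  rw [integral_add' (hI1.sub hI2) (integrable_const _), integral_sub' hI1 hI2, h1, h2,
    integral_const, probReal_univ, one_smul] at h4
  linarith

theorem exists_fract_lt_of_mem_connPB {n : ℕ} (hn : 2 ≤ n) {ρ : ℝ} (hρ1 : ρ ≤ 1)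
    {x : Fin n → ℝ} (hx : x ∈ connPB n ρ) (i : Fin n) :
    ∃ j, j ≠ i ∧ Int.fract (x j - x i) < ρ := by
  obtain ⟨hbox, hgap⟩ := hx
  obtain ⟨k, rfl⟩ := (Tuple.sort x).surjective i
  have hk := hgap k
  rw [circGap] at hk
  split_ifs at hk with h
  · have hmono : x (Tuple.sort x k) ≤ x (Tuple.sort x ⟨k + 1, h⟩) :=
      Tuple.monotone_sort x (Fin.le_def.2 (Nat.le_succ k))
    simp only [sortedCoords] at hk
    refine ⟨Tuple.sort x ⟨k + 1, h⟩, fun he => ?_, ?_⟩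
    · have := congrArg Fin.val ((Tuple.sort x).injective he)
      simp at this
    · rwa [Int.fract_eq_self.2 ⟨by linarith, by linarith⟩]
  · simp only [sortedCoords] at hk
    refine ⟨Tuple.sort x ⟨0, k.pos⟩, fun he => ?_, ?_⟩
    · have := congrArg Fin.val ((Tuple.sort x).injective he)
      simp only at this
      omega
    · have h0 := (hbox (Tuple.sort x ⟨0, k.pos⟩) trivial).1
      have h1 := (hbox (Tuple.sort x k) trivial).2
      rw [← Int.fract_add_one, Int.fract_eq_self.2 ⟨by linarith, by linarith⟩]
      linarith

theorem P_connPB_le_measureReal {n : ℕ} (hn : 2 ≤ n) {ρ : ℝ} (hρ1 : ρ ≤ 1) :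
    P_connPB n ρ ≤ (Measure.pi fun _ : Fin n => unifIcc).real (⋂ i, (emptyArc ρ i)ᶜ) := by
  refine ENNReal.toReal_mono (measure_ne_top _ _) ?_
  rw [← Measure.restrict_pi_pi, ← volume_pi, Measure.restrict_apply
    (MeasurableSet.iInter fun i => (measurableSet_emptyArc ρ i).compl)]
  refine measure_mono fun x hx => ⟨Set.mem_iInter.2 fun i hi => ?_, hx.1⟩
  obtain ⟨j, hji, hj⟩ := exists_fract_lt_of_mem_connPB hn hρ1 hx i
  exact (hi j hji).not_gt hj

theorem P_connPB_le {n : ℕ} (hn : 2 ≤ n) {ρ : ℝ} (hρ0 : 0 ≤ ρ) (hρ1 : ρ ≤ 1 / 2) :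
    P_connPB n ρ ≤ (n * (1 - ρ) ^ (n - 1))⁻¹ + (((1 - ρ) ^ 2)⁻¹ - 1) := by
  obtain ⟨m, rfl⟩ := Nat.exists_eq_add_of_le' hn
  refine (P_connPB_le_measureReal hn (by linarith)).trans ?_
  have hp : ∀ i : Fin (m + 2), (Measure.pi fun _ : Fin (m + 2) => unifIcc).real (emptyArc ρ i) =
      (1 - ρ) ^ (m + 1) := by
    intro i
    rw [measureReal_def, pi_emptyArc hρ0 (by linarith), ENNReal.toReal_pow,
      ENNReal.toReal_ofReal (by linarith)]
  have hpq : ∀ i j : Fin (m + 2), j ≠ i →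
      (Measure.pi fun _ : Fin (m + 2) => unifIcc).real (emptyArc ρ i ∩ emptyArc ρ j) ≤
        ((1 - ρ) ^ 2) ^ m := by
    intro i j hij
    refine (ENNReal.toReal_mono (by finiteness)
      (pi_emptyArc_inter_le hρ0 (by linarith) hij)).trans ?_
    rw [ENNReal.toReal_pow, ENNReal.toReal_ofReal (by linarith)]
    exact pow_le_pow_left₀ (by linarith) (by nlinarith) m
  have h := sq_mul_measureReal_iInter_compl_le (measurableSet_emptyArc ρ) (by positivity) hp hpq
  have hpos : 0 < 1 - ρ := by linarith
  rw [Fintype.card_fin, ← le_div_iff₀' (by positivity)] at h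
  refine h.trans (le_of_eq ?_)
  rw [show m + 2 - 1 = m + 1 from rfl]
  have hne : ((m + 2 : ℕ) : ℝ) ≠ 0 := by positivity
  generalize 1 - ρ = r at hpos
  field_simp
  ring

theorem neg_sub_two_mul_sq_le_log_one_sub {r : ℝ} (hr : r ≤ 1 / 2) :
    -r - 2 * r ^ 2 ≤ Real.log (1 - r) := by
  have hpos : 0 < 1 - r := by linarith
  refine le_trans ?_ (Real.one_sub_inv_le_log_of_pos hpos)
  have : 1 - (1 - r)⁻¹ - (-r - 2 * r ^ 2) = r ^ 2 * (1 - 2 * r) / (1 - r) := by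
    field_simp
    ring
  have : 0 ≤ r ^ 2 * (1 - 2 * r) / (1 - r) :=
    div_nonneg (mul_nonneg (sq_nonneg _) (by linarith)) hpos.le
  linarith

theorem tendsto_zero_of_tendsto_mul_sub_log {ρ : ℕ → ℝ} (hρ : ∀ n, 0 < ρ n)
    (h : Tendsto (fun n : ℕ => (n : ℝ) * ρ n - Real.log n) atTop atBot) :
    Tendsto ρ atTop (nhds 0) := by
  have hlog : Tendsto (fun n : ℕ => Real.log n / n) atTop (nhds 0) :=
    Real.isLittleO_log_id_atTop.tendsto_div_nhds_zero.comp tendsto_natCast_atTop_atTop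
  refine tendsto_of_tendsto_of_tendsto_of_le_of_le' tendsto_const_nhds hlog
    (Eventually.of_forall fun n => (hρ n).le) ?_
  filter_upwards [h.eventually_le_atBot 0, eventually_gt_atTop 0] with n hn hn0
  rw [le_div_iff₀' (by positivity)]
  linarith

theorem tendsto_mul_one_sub_pow_atTop {ρ : ℕ → ℝ} (hρ : ∀ n, 0 < ρ n)
    (h : Tendsto (fun n : ℕ => (n : ℝ) * ρ n - Real.log n) atTop atBot) :
    Tendsto (fun n : ℕ => (n : ℝ) * (1 - ρ n) ^ (n - 1)) atTop atTop := by
  have hexp : Tendsto (fun n : ℕ => Real.exp (-((n : ℝ) * ρ n - Real.log n) + -2)) atTop atTop :=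
    Real.tendsto_exp_atTop.comp
      (tendsto_atTop_add_const_right _ _ (tendsto_neg_atBot_atTop.comp h))
  refine tendsto_atTop_mono' _ ?_ hexp
  have hlog : ∀ᶠ n : ℕ in atTop, ‖Real.log n ^ 2‖ ≤ 1 * ‖(n : ℝ)‖ :=
    tendsto_natCast_atTop_atTop.eventually
      ((Real.isLittleO_pow_log_id_atTop (n := 2)).bound one_pos)
  filter_upwards [h.eventually_le_atBot 0, eventually_gt_atTop 0, hlog,
    (tendsto_zero_of_tendsto_mul_sub_log hρ h).eventually_le_const
      (show (0 : ℝ) < 1 / 2 by norm_num)] with n hn hn0 hl hhalf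
  have hn' : (0 : ℝ) < n := by exact_mod_cast hn0
  have hpos : 0 < 1 - ρ n := by linarith
  rw [one_mul, Real.norm_of_nonneg (sq_nonneg _), Real.norm_of_nonneg hn'.le] at hl
  have hsq : (n : ℝ) * ρ n ^ 2 ≤ 1 := by
    have h1 : ((n : ℝ) * ρ n) ^ 2 ≤ Real.log n ^ 2 :=
      pow_le_pow_left₀ (mul_pos hn' (hρ n)).le (by linarith) 2
    have h2 : (n : ℝ) * (n * ρ n ^ 2) ≤ n * 1 := by nlinarith
    exact le_of_mul_le_mul_left h2 hn'
  calc Real.exp (-((n : ℝ) * ρ n - Real.log n) + -2)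
      ≤ Real.exp (Real.log n + n * Real.log (1 - ρ n)) := by
        refine Real.exp_le_exp.2 ?_
        have := mul_le_mul_of_nonneg_left (neg_sub_two_mul_sq_le_log_one_sub hhalf) hn'.le
        nlinarith
    _ = n * (1 - ρ n) ^ n := by
        rw [Real.exp_add, Real.exp_log hn', Real.exp_nat_mul, Real.exp_log hpos]
    _ ≤ n * (1 - ρ n) ^ (n - 1) := by
        refine mul_le_mul_of_nonneg_left ?_ hn'.le
        exact pow_le_pow_of_le_one hpos.le (by linarith [hρ n]) (Nat.sub_le n 1)

/-- if `n·ρ_n − ln n → −∞`, then the probability of connectedness with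
periodic boundary conditions tends to `0`. -/
theorem P_connPB_tendsto_zero (ρ : ℕ → ℝ) (hρ : ∀ n, 0 < ρ n)
    (h : Tendsto (fun n : ℕ => (n : ℝ) * ρ n - Real.log n) atTop atBot) :
    Tendsto (fun n : ℕ => P_connPB n (ρ n)) atTop (nhds 0) := by
  have hρ0 := tendsto_zero_of_tendsto_mul_sub_log hρ h
  have hlim : Tendsto (fun n : ℕ => ((n : ℝ) * (1 - ρ n) ^ (n - 1))⁻¹ +
      (((1 - ρ n) ^ 2)⁻¹ - 1)) atTop (nhds 0) := by
    have h1 := (tendsto_mul_one_sub_pow_atTop hρ h).inv_tendsto_atTop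
    have h2 := (((hρ0.const_sub 1).pow 2).inv₀ (by norm_num)).sub_const 1
    simpa using h1.add h2
  refine tendsto_of_tendsto_of_tendsto_of_le_of_le' tendsto_const_nhds hlim
    (Eventually.of_forall fun n => ENNReal.toReal_nonneg) ?_
  filter_upwards [eventually_ge_atTop 2,
    hρ0.eventually_le_const (show (0 : ℝ) < 1 / 2 by norm_num)] with n hn hhalf
  exact P_connPB_le hn (hρ n).le hhalf
end

section
/- Let n ≥ 1 and 0 ≤ ρ ≤ 1. Then the probability of the event S that the network is disconnected at the boundary satisfies P(S) = (1 − ρ)^n + n·ρ·(1 − ρ)^{n−1}, where P(S) is the n-dimensional Lebesgue measure of the set S = {x ∈ [0,1]^n : min_i x_i + 1 − max_i x_i ≥ ρ}. -/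
open MeasureTheory Filter

/-- The points of the cube all of whose coordinates lie within `1 - ρ` above the `i`-th one. -/
def minAtSlab {m : ℕ} (ρ : ℝ) (i : Fin (m + 1)) : Set (Fin (m + 1) → ℝ) :=
  {x | x i ∈ Set.Icc (0 : ℝ) 1 ∧
    ∀ j : Fin m, x (i.succAbove j) ∈ Set.Icc (x i) (min 1 (x i + (1 - ρ)))}

theorem integral_min_pow (m : ℕ) {ρ : ℝ} (h0 : 0 ≤ ρ) (h1 : ρ ≤ 1) :
    ∫ t in (0 : ℝ)..1, (min 1 (t + (1 - ρ)) - t) ^ m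
      = ρ * (1 - ρ) ^ m + (1 - ρ) ^ (m + 1) / (m + 1) := by
  have hc : Continuous fun t : ℝ => (min 1 (t + (1 - ρ)) - t) ^ m := by fun_prop
  rw [← intervalIntegral.integral_add_adjacent_intervals (hc.intervalIntegrable 0 ρ)
    (hc.intervalIntegrable ρ 1)]
  congr 1
  · have : ∫ t in (0 : ℝ)..ρ, (min 1 (t + (1 - ρ)) - t) ^ m = ∫ _ in (0 : ℝ)..ρ, (1 - ρ) ^ m := by
      refine intervalIntegral.integral_congr fun t ht => ?_
      rw [Set.uIcc_of_le h0] at ht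
      rw [min_eq_right (by linarith [ht.2])]
      ring
    rw [this]
    simp
  · have : ∫ t in ρ..1, (min 1 (t + (1 - ρ)) - t) ^ m = ∫ t in ρ..1, (1 - t) ^ m := by
      refine intervalIntegral.integral_congr fun t ht => ?_
      rw [Set.uIcc_of_le h1] at ht
      rw [min_eq_left (by linarith [ht.1])]
    rw [this, intervalIntegral.integral_comp_sub_left fun t : ℝ => t ^ m]
    simp

theorem measurableSet_minAtSlab {m : ℕ} (ρ : ℝ) (i : Fin (m + 1)) :
    MeasurableSet (minAtSlab ρ i) := by
  have : IsClosed (minAtSlab ρ i) := by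
    simp only [minAtSlab, Set.mem_Icc, Set.ofPred_and, Set.ofPred_forall]
    refine ((isClosed_le ?_ ?_).inter (isClosed_le ?_ ?_)).inter <| isClosed_iInter fun j =>
      (isClosed_le ?_ ?_).inter (isClosed_le ?_ ?_) <;> fun_prop
  exact this.measurableSet

theorem volume_minAtSlab {m : ℕ} {ρ : ℝ} (h0 : 0 ≤ ρ) (h1 : ρ ≤ 1) (i : Fin (m + 1)) :
    volume (minAtSlab ρ i)
      = ENNReal.ofReal (ρ * (1 - ρ) ^ m + (1 - ρ) ^ (m + 1) / (m + 1)) := by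
  have hmp := (volume_preserving_piFinSuccAbove (fun _ : Fin (m + 1) => ℝ) i).symm
  rw [← hmp.measure_preimage (measurableSet_minAtSlab ρ i).nullMeasurableSet,
    Measure.volume_eq_prod, Measure.prod_apply (hmp.measurable (measurableSet_minAtSlab ρ i))]
  have hslice (t : ℝ) : volume (Prod.mk t ⁻¹'
      ((MeasurableEquiv.piFinSuccAbove (fun _ : Fin (m + 1) => ℝ) i).symm ⁻¹' minAtSlab ρ i))
      = (Set.Icc (0 : ℝ) 1).indicator
        (fun t => ENNReal.ofReal ((min 1 (t + (1 - ρ)) - t) ^ m)) t := by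
    by_cases ht : t ∈ Set.Icc (0 : ℝ) 1
    · have hset : Prod.mk t ⁻¹'
          ((MeasurableEquiv.piFinSuccAbove (fun _ : Fin (m + 1) => ℝ) i).symm ⁻¹' minAtSlab ρ i)
          = Set.univ.pi fun _ : Fin m => Set.Icc t (min 1 (t + (1 - ρ))) := by
        ext y
        simp [minAtSlab, MeasurableEquiv.piFinSuccAbove, Fin.insertNthEquiv, Pi.le_def,
          ht.1, ht.2, forall_and]
      rw [hset, volume_pi_pi, Set.indicator_of_mem ht, ENNReal.ofReal_pow]
      · simp
      · rw [sub_nonneg, le_min_iff]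
        exact ⟨ht.2, by linarith⟩
    · rw [Set.indicator_of_notMem ht]
      convert measure_empty (μ := (volume : Measure (Fin m → ℝ)))
      ext y
      simp only [Set.mem_preimage, Set.mem_empty_iff_false, iff_false]
      rintro ⟨h, -⟩
      apply ht
      simpa [MeasurableEquiv.piFinSuccAbove, Fin.insertNthEquiv] using h
  simp_rw [hslice]
  have hc : Continuous fun t : ℝ => (min 1 (t + (1 - ρ)) - t) ^ m := by fun_prop
  rw [lintegral_indicator measurableSet_Icc, ← ofReal_integral_eq_lintegral_ofReal,
    integral_Icc_eq_integral_Ioc, ← intervalIntegral.integral_of_le zero_le_one,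
    integral_min_pow m h0 h1]
  · exact hc.continuousOn.integrableOn_compact isCompact_Icc
  · refine (ae_restrict_iff' measurableSet_Icc).2 (ae_of_all _ fun t ht => ?_)
    refine pow_nonneg (sub_nonneg.2 (le_min ht.2 ?_)) m
    linarith

theorem volume_setOf_apply_eq_apply {ι : Type*} [Fintype ι] {i j : ι} (hij : i ≠ j) :
    volume {x : ι → ℝ | x i = x j} = 0 := by
  classical
  have h := Measure.addHaar_submodule (volume : Measure (ι → ℝ))
    (LinearMap.ker (LinearMap.proj (R := ℝ) (φ := fun _ : ι => ℝ) i - LinearMap.proj j)) ?_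
  · convert h using 2
    ext x
    simp [sub_eq_zero]
  · intro htop
    have : (Pi.single i 1 : ι → ℝ) ∈ LinearMap.ker
        (LinearMap.proj (R := ℝ) (φ := fun _ : ι => ℝ) i - LinearMap.proj j) :=
      htop ▸ Submodule.mem_top
    simp [hij.symm] at this

theorem apply_le_of_mem_minAtSlab {m : ℕ} {ρ : ℝ} {i : Fin (m + 1)} {x : Fin (m + 1) → ℝ}
    (hx : x ∈ minAtSlab ρ i) (k : Fin (m + 1)) : x i ≤ x k := by
  rcases Fin.eq_self_or_eq_succAbove i k with rfl | ⟨j, rfl⟩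
  · rfl
  · exact (hx.2 j).1

theorem boundaryDisc_eq_iUnion_minAtSlab {m : ℕ} {ρ : ℝ} (h1 : ρ ≤ 1) :
    boundaryDisc (m + 1) ρ = ⋃ i, minAtSlab ρ i := by
  ext x
  have hle (k : Fin (m + 1)) : x k ≤ ⨆ i, x i := le_ciSup (Set.finite_range x).bddAbove k
  have hge (k : Fin (m + 1)) : ⨅ i, x i ≤ x k := ciInf_le (Set.finite_range x).bddBelow k
  simp only [boundaryDisc, unitBox, Set.mem_ofPred_eq, Set.mem_univ_pi, Set.mem_iUnion]
  constructor
  · rintro ⟨hbox, hgap⟩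
    obtain ⟨i, hi⟩ := exists_eq_ciInf_of_finite (f := x)
    refine ⟨i, hbox i, fun j => ⟨hi ▸ hge _, le_min (hbox _).2 ?_⟩⟩
    linarith [hle (i.succAbove j)]
  · rintro ⟨i, hx⟩
    have hmin := apply_le_of_mem_minAtSlab hx
    have hmax (k : Fin (m + 1)) : x k ≤ min 1 (x i + (1 - ρ)) := by
      rcases Fin.eq_self_or_eq_succAbove i k with rfl | ⟨j, rfl⟩
      · exact le_min hx.1.2 (by linarith)
      · exact (hx.2 j).2
    refine ⟨fun k => ⟨hx.1.1.trans (hmin k), (hmax k).trans (min_le_left _ _)⟩, ?_⟩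
    have hinf : x i ≤ ⨅ k, x k := le_ciInf hmin
    have hsup : ⨆ k, x k ≤ x i + (1 - ρ) :=
      ciSup_le fun k => (hmax k).trans (min_le_right _ _)
    linarith

/-- the probability of the event S that the network is disconnected at the
boundary is `(1-ρ)^n + nρ(1-ρ)^{n-1}`. -/
theorem P_boundaryDisc (n : ℕ) (hn : 1 ≤ n) (ρ : ℝ) (h0 : 0 ≤ ρ) (h1 : ρ ≤ 1) :
    (volume (boundaryDisc n ρ)).toReal
      = (1 - ρ) ^ n + (n : ℝ) * ρ * (1 - ρ) ^ (n - 1) := by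
  obtain ⟨m, rfl⟩ : ∃ m, n = m + 1 := ⟨n - 1, by omega⟩
  have hdisj : Pairwise (Function.onFun (AEDisjoint volume) (minAtSlab (m := m) ρ)) := by
    intro i j hij
    refine measure_mono_null ?_ (volume_setOf_apply_eq_apply hij)
    rintro x ⟨hi, hj⟩
    exact le_antisymm (apply_le_of_mem_minAtSlab hi j) (apply_le_of_mem_minAtSlab hj i)
  have hL : 0 ≤ 1 - ρ := sub_nonneg.2 h1
  rw [boundaryDisc_eq_iUnion_minAtSlab h1,
    measure_iUnion₀ hdisj fun i => (measurableSet_minAtSlab ρ i).nullMeasurableSet]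
  simp only [volume_minAtSlab h0 h1, tsum_fintype, Finset.sum_const, Finset.card_univ,
    Fintype.card_fin, nsmul_eq_mul, ENNReal.toReal_mul, ENNReal.toReal_natCast]
  rw [ENNReal.toReal_ofReal (by positivity), Nat.add_sub_cancel]
  push_cast
  field_simp
  ring
end

section
/- Let (ρ_n) be a sequence of positive reals such that n·ρ_n − ln n → +∞ as n → ∞. Then the probability of connectedness of the 1-dimensional MANET with disconnected boundary conditions satisfies P_{CONN-DB}(n, ρ_n) → 1 as n → ∞. -/
open MeasureTheory Filter

/-- The pairs `(a, y)` such that `a` and all coordinates of `y` lie in `[0,1]`, the interval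
`(a, a + ρ)` is contained in `[0,1]`, and it contains no coordinate of `y`. -/
def gapSet (m : ℕ) (ρ : ℝ) : Set (ℝ × (Fin m → ℝ)) :=
  {p | p.1 ∈ Set.Icc 0 (1 - ρ) ∧ ∀ i, p.2 i ∈ Set.Icc 0 p.1 ∪ Set.Icc (p.1 + ρ) 1}

lemma isClosed_gapSet (m : ℕ) (ρ : ℝ) : IsClosed (gapSet m ρ) := by
  simp only [gapSet, Set.mem_union, Set.mem_Icc, Set.ofPred_and, Set.ofPred_forall, Set.ofPred_or]
  refine IsClosed.inter (IsClosed.inter ?_ ?_) (isClosed_iInter fun i =>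
    IsClosed.union (IsClosed.inter ?_ ?_) (IsClosed.inter ?_ ?_)) <;>
  exact isClosed_le (by fun_prop) (by fun_prop)

lemma volume_gapSet_le (m : ℕ) (ρ : ℝ) :
    volume (gapSet m ρ) ≤ ENNReal.ofReal (1 - ρ) ^ (m + 1) := by
  rw [Measure.volume_eq_prod, Measure.prod_apply (isClosed_gapSet m ρ).measurableSet]
  calc ∫⁻ a : ℝ, volume (Prod.mk a ⁻¹' gapSet m ρ)
      ≤ ∫⁻ a : ℝ, (Set.Icc 0 (1 - ρ)).indicator (fun _ => ENNReal.ofReal (1 - ρ) ^ m) a := by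
        refine lintegral_mono fun a => ?_
        by_cases ha : a ∈ Set.Icc 0 (1 - ρ)
        · have hsub : Prod.mk a ⁻¹' gapSet m ρ ⊆
              Set.univ.pi fun _ => Set.Icc 0 a ∪ Set.Icc (a + ρ) 1 := fun y hy i _ => hy.2 i
          have hunion : volume (Set.Icc 0 a ∪ Set.Icc (a + ρ) 1) ≤ ENNReal.ofReal (1 - ρ) := by
            refine (measure_union_le _ _).trans ?_
            rw [Real.volume_Icc, Real.volume_Icc,
              ← ENNReal.ofReal_add (by linarith [ha.1]) (by linarith [ha.2])]
            exact ENNReal.ofReal_le_ofReal (by linarith)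
          rw [Set.indicator_of_mem ha]
          refine (measure_mono hsub).trans ?_
          rw [volume_pi_pi, Finset.prod_const, Finset.card_univ, Fintype.card_fin]
          gcongr
        · have hempty : Prod.mk a ⁻¹' gapSet m ρ = ∅ :=
            Set.eq_empty_of_forall_notMem fun y hy => ha hy.1
          simp [hempty]
    _ = ENNReal.ofReal (1 - ρ) ^ (m + 1) := by
        rw [lintegral_indicator_const measurableSet_Icc, Real.volume_Icc, sub_zero, pow_succ]

lemma P_connDB_le_one (n : ℕ) (ρ : ℝ) : P_connDB n ρ ≤ 1 := by
  refine ENNReal.toReal_le_of_le_ofReal zero_le_one ?_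
  rw [ENNReal.ofReal_one, ← volume_unitBox n]
  exact measure_mono fun x hx => hx.1

/-- A configuration in the unit box that is not connected has an empty interval of length `ρ`
immediately to the right of some coordinate. -/
lemma unitBox_subset_connDB_union (m : ℕ) (ρ : ℝ) :
    unitBox (m + 1) ⊆ connDB (m + 1) ρ ∪
      ⋃ j : Fin (m + 1),
        MeasurableEquiv.piFinSuccAbove (fun _ => ℝ) j ⁻¹' gapSet m ρ := by
  intro x hx
  by_cases hc : x ∈ connDB (m + 1) ρ
  · exact Or.inl hc
  right
  have hbox : ∀ k, 0 ≤ x k ∧ x k ≤ 1 := fun k => hx k trivial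
  simp only [connDB, Set.mem_ofPred_eq, hx, true_and, not_forall, not_lt] at hc
  obtain ⟨i, hi, hgap⟩ := hc
  have hmono : Monotone (sortedCoords x) := Tuple.monotone_sort x
  have hnext : x (Tuple.sort x ⟨i + 1, hi⟩) ≤ 1 := (hbox _).2
  have hsplit : ∀ k, x k ≤ x (Tuple.sort x i) ∨ x (Tuple.sort x i) + ρ ≤ x k := by
    intro k
    obtain ⟨l, rfl⟩ := (Tuple.sort x).surjective k
    rcases le_or_gt l i with hl | hl
    · exact Or.inl (hmono hl)
    · have hle : sortedCoords x ⟨i + 1, hi⟩ ≤ sortedCoords x l :=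
        hmono (Fin.mk_le_of_le_val (Nat.succ_le_of_lt hl))
      simp only [sortedCoords] at hgap hle
      exact Or.inr (by linarith)
  simp only [sortedCoords] at hgap
  refine Set.mem_iUnion.2 ⟨Tuple.sort x i, ⟨(hbox _).1, ?_⟩, fun k => ?_⟩
  · change x (Tuple.sort x i) ≤ 1 - ρ
    linarith
  · have hk := hbox ((Tuple.sort x i).succAbove k)
    exact (hsplit ((Tuple.sort x i).succAbove k)).imp (fun h => ⟨hk.1, h⟩) fun h => ⟨h, hk.2⟩

lemma one_sub_le_P_connDB {n : ℕ} (hn : n ≠ 0) (ρ : ℝ) :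
    1 - Real.exp (-(n * ρ - Real.log n)) ≤ P_connDB n ρ := by
  obtain ⟨m, rfl⟩ := Nat.exists_eq_succ_of_ne_zero hn
  have hfin : volume (connDB (m + 1) ρ) ≠ ⊤ :=
    measure_ne_top_of_subset (fun x hx => hx.1) (by simp [volume_unitBox])
  have hgap : ∀ j : Fin (m + 1),
      volume (MeasurableEquiv.piFinSuccAbove (fun _ => ℝ) j ⁻¹' gapSet m ρ) ≤
        ENNReal.ofReal (Real.exp (-((m + 1) * ρ))) := by
    intro j
    rw [(volume_preserving_piFinSuccAbove (fun _ => ℝ) j).measure_preimage_equiv]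
    refine (volume_gapSet_le m ρ).trans ?_
    calc ENNReal.ofReal (1 - ρ) ^ (m + 1)
        ≤ ENNReal.ofReal (Real.exp (-ρ)) ^ (m + 1) := by
          gcongr
          exact Real.one_sub_le_exp_neg ρ
      _ = ENNReal.ofReal (Real.exp (-((m + 1) * ρ))) := by
          rw [← ENNReal.ofReal_pow (Real.exp_pos _).le, ← Real.exp_nat_mul]
          push_cast
          ring_nf
  have hexp : Real.exp (-(((m + 1 : ℕ) : ℝ) * ρ - Real.log ((m + 1 : ℕ) : ℝ))) =
      (m + 1) * Real.exp (-((m + 1) * ρ)) := by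
    rw [neg_sub, sub_eq_add_neg, Real.exp_add, Real.exp_log (by positivity)]
    push_cast
    rfl
  have hmeas : (1 : ENNReal) ≤
      ENNReal.ofReal (P_connDB (m + 1) ρ + (m + 1) * Real.exp (-((m + 1) * ρ))) := by
    calc (1 : ENNReal) = volume (unitBox (m + 1)) := (volume_unitBox _).symm
      _ ≤ volume (connDB (m + 1) ρ) + ∑ j : Fin (m + 1),
            volume (MeasurableEquiv.piFinSuccAbove (fun _ => ℝ) j ⁻¹' gapSet m ρ) :=
          (measure_mono (unitBox_subset_connDB_union m ρ)).trans
            ((measure_union_le _ _).trans (by gcongr; exact measure_iUnion_fintype_le _ _))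
      _ ≤ volume (connDB (m + 1) ρ) +
            ∑ _j : Fin (m + 1), ENNReal.ofReal (Real.exp (-((m + 1) * ρ))) := by
          gcongr with j
          exact hgap j
      _ = _ := by
          rw [Finset.sum_const, Finset.card_univ, Fintype.card_fin, nsmul_eq_mul, P_connDB,
            ENNReal.ofReal_add ENNReal.toReal_nonneg (by positivity),
            ENNReal.ofReal_toReal hfin, ENNReal.ofReal_mul (by positivity)]
          congr 2
          rw [← Nat.cast_succ, ENNReal.ofReal_natCast]
  rw [Nat.succ_eq_add_one, hexp]
  linarith [ENNReal.one_le_ofReal.1 hmeas]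

/-- if `n·ρ_n − ln n → +∞`, then the probability of connectedness with
disconnected boundary conditions tends to `1`. -/
theorem P_connDB_tendsto_one (ρ : ℕ → ℝ) (hρ : ∀ n, 0 < ρ n)
    (h : Tendsto (fun n : ℕ => (n : ℝ) * ρ n - Real.log n) atTop atTop) :
    Tendsto (fun n : ℕ => P_connDB n (ρ n)) atTop (nhds 1) := by
  have hlim : Tendsto (fun n : ℕ => 1 - Real.exp (-((n : ℝ) * ρ n - Real.log n))) atTop
      (nhds 1) := by
    simpa using (Real.tendsto_exp_neg_atTop_nhds_zero.comp h).const_sub 1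
  refine tendsto_of_tendsto_of_tendsto_of_le_of_le' hlim tendsto_const_nhds ?_
    (Eventually.of_forall fun n => P_connDB_le_one n (ρ n))
  filter_upwards [eventually_ne_atTop 0] with n hn
  exact one_sub_le_P_connDB hn (ρ n)
end
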